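/- Let d ≥ 4 and let P be a simplicial d-polytope in ℝ^d with natural embedding p. Suppose the graph of ∂P contains a chordless 4-cycle on vertices u, v, w, z, i.e., {u,v}, {v,w}, {w,z}, {z,u} are edges of ∂P while {u,w} and {v,z} are not. Then for each edge e of this 4-cycle there exists a stress on the framework (∂P, p) (on the full graph of ∂P) that is nonzero on e. -/

import Mathlib

open Finset
open scoped Classical

noncomputable section

/-- A finite graph: a finite vertex set together with a finite set of edges,
where each edge is (intended to be) a 2-element subset of the vertex set. -/
structure FinGraph (ι : Type) where
  verts : Finset ι
  edges : Finset (Finset ι)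

/-- Every edge is a 2-element subset of the vertex set. -/
def FinGraph.Good {ι : Type} (G : FinGraph ι) : Prop :=
  ∀ e ∈ G.edges, e ⊆ G.verts ∧ e.card = 2

/-- The standard inner (dot) product on `ℝ^d`. -/
def dotR {d : ℕ} (x y : Fin d → ℝ) : ℝ := ∑ i, x i * y i

/-- An infinitesimal motion of the framework `(G, p)`. -/
def IsMotion {ι : Type} {d : ℕ} (G : FinGraph ι) (p m : ι → Fin d → ℝ) : Prop :=
  ∀ e ∈ G.edges, ∀ u ∈ e, ∀ v ∈ e, dotR (p u - p v) (m u - m v) = 0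

/-- The framework `(G, p)` is infinitesimally rigid in `ℝ^d`: every infinitesimal
motion is the restriction of a motion `x ↦ A x + b` of `ℝ^d` with `A` skew-symmetric. -/
def IsInfRigid {ι : Type} (d : ℕ) (G : FinGraph ι) (p : ι → Fin d → ℝ) : Prop :=
  ∀ m : ι → Fin d → ℝ, IsMotion G p m →
    ∃ (A : Matrix (Fin d) (Fin d) ℝ) (b : Fin d → ℝ),
      A.transpose = -A ∧ ∀ v ∈ G.verts, m v = A.mulVec (p v) + b

/-- A stress on the framework `(G, p)`. -/
def IsStress {ι : Type} {d : ℕ} (G : FinGraph ι) (p : ι → Fin d → ℝ)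
    (ω : Finset ι → ℝ) : Prop :=
  ∀ v ∈ G.verts,
    (∑ e ∈ G.edges.filter (fun e => v ∈ e), ∑ u ∈ e.erase v, ω e • (p v - p u)) = 0

/-- A centrally symmetric framework with free involution `ν` satisfying `p (ν v) = -(p v)`. -/
def IsCSFramework {ι : Type} {d : ℕ} (G : FinGraph ι) (p : ι → Fin d → ℝ) (ν : ι → ι) : Prop :=
  (∀ v ∈ G.verts, ν (ν v) = v) ∧
  (∀ v ∈ G.verts, ν v ∈ G.verts) ∧
  (∀ v ∈ G.verts, ν v ≠ v) ∧
  (∀ e ∈ G.edges, e.image ν ∈ G.edges) ∧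
  (∀ e ∈ G.edges, e.image ν ≠ e) ∧
  (∀ v ∈ G.verts, p (ν v) = -(p v))

/-- The convex body spanned by a finite point set. -/
def polyBody {d : ℕ} (V : Finset (Fin d → ℝ)) : Set (Fin d → ℝ) :=
  convexHull ℝ (V : Set (Fin d → ℝ))

/-- `(f, c)` is a supporting functional for `conv V` exposing the face `F`. -/
def IsSupport {d : ℕ} (V : Finset (Fin d → ℝ)) (f : (Fin d → ℝ) →ₗ[ℝ] ℝ) (c : ℝ)
    (F : Set (Fin d → ℝ)) : Prop :=
  (∀ y ∈ polyBody V, f y ≤ c) ∧ F = {y ∈ polyBody V | f y = c}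

/-- A proper face of the polytope `conv V`. -/
def IsProperFace {d : ℕ} (V : Finset (Fin d → ℝ)) (F : Set (Fin d → ℝ)) : Prop :=
  (∃ f c, IsSupport V f c F) ∧ F ≠ polyBody V

/-- A simplicial `d`-polytope in `ℝ^d`, recorded by its vertex set `V`: the polytope is
`conv V`, it is `d`-dimensional, every element of `V` is a vertex, and every proper face
is a simplex (the convex hull of its affinely independent vertex set). -/
structure SPolytope (d : ℕ) where
  V : Finset (Fin d → ℝ)
  span_top : affineSpan ℝ (V : Set (Fin d → ℝ)) = ⊤
  extreme : ∀ v ∈ V, v ∉ convexHull ℝ ((V.erase v : Finset (Fin d → ℝ)) : Set (Fin d → ℝ))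
  simplicial : ∀ F : Set (Fin d → ℝ), IsProperFace V F →
    AffineIndependent ℝ
      (fun x : {y : Fin d → ℝ // y ∈ (V : Set (Fin d → ℝ)) ∩ F} => (x : Fin d → ℝ)) ∧
    F = convexHull ℝ ((V : Set (Fin d → ℝ)) ∩ F)

/-- `s` is a face of the boundary complex `∂P`. -/
def BFace {d : ℕ} (P : SPolytope d) (s : Finset (Fin d → ℝ)) : Prop :=
  s ⊆ P.V ∧ ∃ F : Set (Fin d → ℝ), IsProperFace P.V F ∧ (s : Set (Fin d → ℝ)) ⊆ F

/-- The number of vertices of `∂P`. -/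
def f0 {d : ℕ} (P : SPolytope d) : ℕ := P.V.card

/-- The edges of `∂P`. -/
def edgeFinset {d : ℕ} (P : SPolytope d) : Finset (Finset (Fin d → ℝ)) :=
  P.V.powerset.filter fun e => e.card = 2 ∧ BFace P e

/-- The number of edges of `∂P`. -/
def f1 {d : ℕ} (P : SPolytope d) : ℕ := (edgeFinset P).card

/-- `g₂(P) = f₁ - d f₀ + C(d+1, 2)`. -/
def g2 {d : ℕ} (P : SPolytope d) : ℤ :=
  (f1 P : ℤ) - (d : ℤ) * (f0 P : ℤ) + ((d + 1).choose 2 : ℤ)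

/-- `P` is centrally symmetric. -/
def IsCS {d : ℕ} (P : SPolytope d) : Prop := ∀ v ∈ P.V, -v ∈ P.V

/-- A missing face of `∂P`. -/
def IsMissingFace {d : ℕ} (P : SPolytope d) (σ : Finset (Fin d → ℝ)) : Prop :=
  σ ⊆ P.V ∧ ¬ BFace P σ ∧ ∀ τ ⊂ σ, BFace P τ

/-- `P` is prime: `∂P` has no missing facet, i.e. no missing face of cardinality `d`. -/
def IsPrimePoly {d : ℕ} (P : SPolytope d) : Prop :=
  ¬ ∃ σ : Finset (Fin d → ℝ), IsMissingFace P σ ∧ σ.card = d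

/-- The graph (1-skeleton) of `∂P` as a framework graph. -/
def fullGraph {d : ℕ} (P : SPolytope d) : FinGraph (Fin d → ℝ) :=
  ⟨P.V, edgeFinset P⟩

/-- The graph (1-skeleton) of the star of the face `τ` in `∂P`. -/
def starGraph {d : ℕ} (P : SPolytope d) (τ : Finset (Fin d → ℝ)) : FinGraph (Fin d → ℝ) :=
  ⟨P.V.filter fun v => BFace P (insert v τ),
   P.V.powerset.filter fun e => e.card = 2 ∧ BFace P (e ∪ τ)⟩

/-- Adjacency in the graph of `∂P`. -/
def Adj {d : ℕ} (P : SPolytope d) (u v : Fin d → ℝ) : Prop :=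
  u ≠ v ∧ BFace P {u, v}

/-- `σ` is a face of the link of the face `τ` in `∂P`. -/
def LinkFace {d : ℕ} (P : SPolytope d) (τ σ : Finset (Fin d → ℝ)) : Prop :=
  Disjoint σ τ ∧ BFace P (σ ∪ τ)

/-- `P` is a `d`-dimensional cross-polytope: its vertex set is `{±b₁, …, ±b_d}`
for some basis `b₁, …, b_d` of `ℝ^d`. -/
def IsCrossPolytope {d : ℕ} (P : SPolytope d) : Prop :=
  ∃ b : Fin d → (Fin d → ℝ), LinearIndependent ℝ b ∧
    (P.V : Set (Fin d → ℝ)) = Set.range b ∪ Set.range (fun i => -(b i))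

/-- A facet of `P`: a proper face with `d` vertices. -/
def IsFacet {d : ℕ} (P : SPolytope d) (F : Set (Fin d → ℝ)) : Prop :=
  IsProperFace P.V F ∧ ((P.V : Set (Fin d → ℝ)) ∩ F).ncard = d

/-- `x` lies beyond exactly one facet of `P`: it is strictly separated from `P` by the
affine hull of one facet `F`, and not separated from `P` by the affine hull of any
other facet. -/
def BeyondExactlyOne {d : ℕ} (P : SPolytope d) (x : Fin d → ℝ) : Prop :=
  ∃ F : Set (Fin d → ℝ), IsFacet P F ∧
    (∀ f c, IsSupport P.V f c F → c < f x) ∧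
    (∀ F' : Set (Fin d → ℝ), IsFacet P F' → F' ≠ F →
      ∀ f c, IsSupport P.V f c F' → f x < c)

/-- `P` is obtained from a `d`-dimensional cross-polytope by symmetric stacking: there is
a sequence of cs simplicial `d`-polytopes starting at a cross-polytope and ending at `P`,
each obtained from the previous one as `conv (P_k ∪ {v, -v})` for a point `v` lying
beyond exactly one facet of `P_k`. -/
def SymmetricStackingFrom {d : ℕ} (P : SPolytope d) : Prop :=
  ∃ (m : ℕ) (Q : Fin (m + 1) → SPolytope d),
    (∀ k, IsCS (Q k)) ∧
    IsCrossPolytope (Q 0) ∧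
    Q (Fin.last m) = P ∧
    ∀ k : Fin m, ∃ v : Fin d → ℝ,
      BeyondExactlyOne (Q (Fin.castSucc k)) v ∧
      polyBody (Q (Fin.succ k)).V =
        convexHull ℝ (polyBody (Q (Fin.castSucc k)).V ∪ {v, -v})

/-- `P` is a stacked `d`-polytope: obtained from a `d`-simplex by repeatedly adding a
point beyond exactly one facet. -/
def IsStacked {d : ℕ} (P : SPolytope d) : Prop :=
  ∃ (m : ℕ) (R : Fin (m + 1) → SPolytope d),
    (R 0).V.card = d + 1 ∧
    R (Fin.last m) = P ∧
    ∀ k : Fin m, ∃ v : Fin d → ℝ,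
      BeyondExactlyOne (R (Fin.castSucc k)) v ∧
      polyBody (R (Fin.succ k)).V =
        convexHull ℝ (polyBody (R (Fin.castSucc k)).V ∪ {v})

/-- Every `d` vertices of `P`, no two of which are antipodal, are affinely independent. -/
def GenPos {d : ℕ} (P : SPolytope d) : Prop :=
  ∀ S : Finset (Fin d → ℝ), S ⊆ P.V → S.card = d →
    (∀ x ∈ S, ∀ y ∈ S, x ≠ -y) →
    AffineIndependent ℝ (fun s : {x : Fin d → ℝ // x ∈ S} => (s : Fin d → ℝ))

/-- The graph of the cone `v₀ * S` over a simplicial complex `S` (a set of finsets):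
the vertices of `S` together with `v₀`, and the edges of `S` together with all edges
from `v₀` to vertices of `S`. -/
def coneGraph {d : ℕ} (P : SPolytope d) (v0 : Fin d → ℝ)
    (S : Set (Finset (Fin d → ℝ))) : FinGraph (Fin d → ℝ) :=
  ⟨insert v0 (P.V.filter fun u => ({u} : Finset (Fin d → ℝ)) ∈ S),
   (P.V.powerset.filter fun e => e.card = 2 ∧ e ∈ S) ∪
     (P.V.filter fun u => ({u} : Finset (Fin d → ℝ)) ∈ S).image
       fun u => ({v0, u} : Finset (Fin d → ℝ))⟩

structure SphData (ι W : Type) [AddCommGroup W] [Module ℝ W] (d : ℕ) where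
  p : ι → W
  o : W
  Fs : Finset (Finset ι)
  l : Finset ι → W →ₗ[ℝ] ℝ
  c : Finset ι → ι → W →ₗ[ℝ] ℝ
  vol : Finset ι → ℝ
  card_eq : ∀ F ∈ Fs, F.card = d
  l_o : ∀ F ∈ Fs, l F o = 1
  l_zero : ∀ F ∈ Fs, ∀ x ∈ F, l F (p x) = 0
  l_pos : ∀ F ∈ Fs, ∀ G ∈ Fs, ∀ x ∈ G, x ∉ F → 0 < l F (p x)
  decomp : ∀ F ∈ Fs, ∀ a, a = ∑ x ∈ F, c F x a • p x + l F a • o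
  c_o : ∀ F ∈ Fs, ∀ x ∈ F, c F x o = 0
  c_self : ∀ F ∈ Fs, ∀ x ∈ F, c F x (p x) = 1
  c_ne : ∀ F ∈ Fs, ∀ x ∈ F, ∀ y ∈ F, x ≠ y → c F x (p y) = 0
  vol_pos : ∀ F ∈ Fs, 0 < vol F
  adj : ∀ F ∈ Fs, ∀ x ∈ F, ∃ x', x' ∉ F ∧ insert x' (F.erase x) ∈ Fs ∧
    vol (insert x' (F.erase x)) = |c F x (p x')| * vol F

namespace SphData

variable {ι W : Type} [AddCommGroup W] [Module ℝ W] {d : ℕ} (S : SphData ι W d)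

/-- applying a functional to the decomposition -/
lemma app (k : W →ₗ[ℝ] ℝ) {F : Finset ι} (hF : F ∈ S.Fs) (a : W) :
    k a = ∑ x ∈ F, S.c F x a * k (S.p x) + S.l F a * k S.o := by
  conv_lhs => rw [S.decomp F hF a]
  simp [map_sum]

/-- a functional killing the ridge -/
lemma app_ridge (k : W →ₗ[ℝ] ℝ) {F : Finset ι} (hF : F ∈ S.Fs) {x : ι} (hx : x ∈ F)
    (hk : ∀ y ∈ F.erase x, k (S.p y) = 0) (a : W) :
    k a = S.c F x a * k (S.p x) + S.l F a * k S.o := by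
  rw [S.app k hF a, ← Finset.add_sum_erase F _ hx]
  rw [Finset.sum_eq_zero (s := F.erase x)]
  · ring
  · intro y hy
    rw [hk y hy, mul_zero]

lemma c_neg {F : Finset ι} (hF : F ∈ S.Fs) {x x' : ι} (hx : x ∈ F) (hx' : x' ∉ F)
    (hG : insert x' (F.erase x) ∈ S.Fs) : S.c F x (S.p x') < 0 := by
  have hne : x ≠ x' := fun h => hx' (h ▸ hx)
  have h := S.app_ridge (S.l (insert x' (F.erase x))) hF hx
    (fun y hy => S.l_zero _ hG y (mem_insert_of_mem hy)) (S.p x')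
  rw [S.l_zero _ hG x' (mem_insert_self _ _), S.l_o _ hG] at h
  have h1 := S.l_pos _ hG _ hF x hx (by simp [hne])
  have h2 := S.l_pos _ hF _ hG x' (mem_insert_self _ _) hx'
  nlinarith

lemma adj_unique {F : Finset ι} (hF : F ∈ S.Fs) {x a b : ι} (hx : x ∈ F) (ha : a ∉ F)
    (hb : b ∉ F) (hG : insert a (F.erase x) ∈ S.Fs) (hH : insert b (F.erase x) ∈ S.Fs) :
    a = b := by
  by_contra hab
  have hxa : x ≠ a := fun h => ha (h ▸ hx)
  have hxb : x ≠ b := fun h => hb (h ▸ hx)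
  have ca := S.c_neg hF hx ha hG
  have cb := S.c_neg hF hx hb hH
  have hGr := S.app_ridge (S.l (insert a (F.erase x))) hF hx
    (fun y hy => S.l_zero _ hG y (mem_insert_of_mem hy))
  have hHr := S.app_ridge (S.l (insert b (F.erase x))) hF hx
    (fun y hy => S.l_zero _ hH y (mem_insert_of_mem hy))
  have e1 := hGr (S.p a)
  have e2 := hGr (S.p b)
  have e3 := hHr (S.p a)
  have e4 := hHr (S.p b)
  rw [S.l_zero _ hG a (mem_insert_self _ _), S.l_o _ hG] at e1
  rw [S.l_o _ hG] at e2
  rw [S.l_o _ hH] at e3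
  rw [S.l_zero _ hH b (mem_insert_self _ _), S.l_o _ hH] at e4
  have p1 := S.l_pos _ hG _ hH b (mem_insert_self _ _) (by simp [Ne.symm hab, hb])
  have p2 := S.l_pos _ hH _ hG a (mem_insert_self _ _) (by simp [hab, ha])
  rw [e2] at p1
  rw [e3] at p2
  have q1 : S.l F (S.p a) = - S.c F x (S.p a) * S.l (insert a (F.erase x)) (S.p x) := by linarith
  have q2 : S.l F (S.p b) = - S.c F x (S.p b) * S.l (insert b (F.erase x)) (S.p x) := by linarith
  rw [q2] at p1
  rw [q1] at p2
  have r1 : S.l (insert b (F.erase x)) (S.p x) > S.l (insert a (F.erase x)) (S.p x) := by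
    nlinarith
  have r2 : S.l (insert b (F.erase x)) (S.p x) < S.l (insert a (F.erase x)) (S.p x) := by
    nlinarith
  linarith

/-- all vertices -/
def U : Finset ι := S.Fs.biUnion id

/-- facets containing a face -/
def st (τ : Finset ι) : Finset (Finset ι) := S.Fs.filter (fun F => τ ⊆ F)

lemma mem_st {τ F : Finset ι} : F ∈ S.st τ ↔ F ∈ S.Fs ∧ τ ⊆ F := by
  simp [st]

/-- value at `r` of the piecewise linear function on the cone of `F` -/
def ev (r : W) (F : Finset ι) (f : ι → ℝ) : ℝ := ∑ x ∈ F, S.c F x r * f x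

def wt (r : W) (τ F : Finset ι) : ℝ := (S.vol F * ∏ x ∈ F \ τ, S.c F x r)⁻¹

/-- genericity -/
def Gen (r : W) : Prop := ∀ F ∈ S.Fs, ∀ x ∈ F, S.c F x r ≠ 0

lemma wt_insert {r : W} (hr : S.Gen r) {τ F : Finset ι} (hF : F ∈ S.Fs) {x : ι}
    (hx : x ∈ F) (hxτ : x ∉ τ) : S.wt r τ F * S.c F x r = S.wt r (insert x τ) F := by
  unfold wt
  have h : ∏ y ∈ F \ τ, S.c F y r = S.c F x r * ∏ y ∈ F \ insert x τ, S.c F y r := by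
    rw [← Finset.mul_prod_erase (F \ τ) _ (mem_sdiff.2 ⟨hx, hxτ⟩)]
    congr 2
    ext y; simp; tauto
  rw [h]
  have := hr F hF x hx
  have := (S.vol_pos F hF).ne'
  rw [mul_inv, mul_inv, mul_inv]
  field_simp

lemma wt_ne {r : W} (hr : S.Gen r) {τ F : Finset ι} (hF : F ∈ S.Fs) : S.wt r τ F ≠ 0 := by
  unfold wt
  apply inv_ne_zero
  apply mul_ne_zero (S.vol_pos F hF).ne'
  rw [Finset.prod_ne_zero_iff]
  intro x hx
  exact hr F hF x (mem_sdiff.1 hx).1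

lemma drop {r : W} (hr : S.Gen r) (τ : Finset ι) (f : ι → ℝ) (hf : ∀ t ∈ τ, f t = 0)
    (φ : Finset ι → ℝ) :
    ∑ F ∈ S.st τ, S.wt r τ F * S.ev r F f * φ F =
      ∑ x ∈ S.U \ τ, f x * ∑ F ∈ S.st (insert x τ), S.wt r (insert x τ) F * φ F := by
  have h1 : ∀ F ∈ S.st τ, S.wt r τ F * S.ev r F f * φ F =
      ∑ x ∈ S.U \ τ, if x ∈ F then f x * (S.wt r (insert x τ) F * φ F) else 0 := by
    intro F hF
    rw [mem_st] at hF
    rw [← Finset.sum_filter]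
    have h2 : (S.U \ τ).filter (fun x => x ∈ F) = F \ τ := by
      ext x
      simp only [mem_filter, mem_sdiff, U, mem_biUnion, id]
      constructor
      · rintro ⟨⟨_, h⟩, h'⟩; exact ⟨h', h⟩
      · rintro ⟨h', h⟩; exact ⟨⟨⟨F, hF.1, h'⟩, h⟩, h'⟩
    rw [h2]
    have h3 : S.ev r F f = ∑ x ∈ F \ τ, S.c F x r * f x := by
      unfold ev
      symm
      apply Finset.sum_subset sdiff_subset
      intro x hx hx'
      have : x ∈ τ := by
        by_contra h
        exact hx' (mem_sdiff.2 ⟨hx, h⟩)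
      rw [hf x this, mul_zero]
    rw [h3, Finset.mul_sum, Finset.sum_mul]
    apply Finset.sum_congr rfl
    intro x hx
    rw [mem_sdiff] at hx
    rw [← S.wt_insert hr hF.1 hx.1 hx.2]
    ring
  rw [Finset.sum_congr rfl h1, Finset.sum_comm]
  apply Finset.sum_congr rfl
  intro x hx
  rw [← Finset.sum_filter, Finset.mul_sum]
  apply Finset.sum_congr _ (fun _ _ => rfl)
  ext F
  simp only [st, mem_filter, insert_subset_iff]
  tauto

lemma ev_lin {r : W} (k : W →ₗ[ℝ] ℝ) {F : Finset ι} (hF : F ∈ S.Fs) :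
    S.ev r F (fun x => k (S.p x)) = k r - S.l F r * k S.o := by
  rw [S.app k hF r]
  unfold ev
  ring

/-- normalisation along a face -/
lemma shift {r : W} (hr : S.Gen r) {τ F₀ : Finset ι} (hF₀ : F₀ ∈ S.Fs) (hτ : τ ⊆ F₀)
    {y : ι} (hy : y ∈ F₀) (hyτ : y ∉ τ) (f : ι → ℝ) :
    ∃ f' : ι → ℝ, (∀ t ∈ τ, f' t = 0) ∧ ∀ F ∈ S.Fs, S.ev r F f' = S.ev r F f := by
  let k : W →ₗ[ℝ] ℝ := ∑ t ∈ τ, f t • (S.c F₀ t - (S.c F₀ t r / S.c F₀ y r) • S.c F₀ y)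
  have hyr := hr _ hF₀ y hy
  have kr : k r = 0 := by
    simp only [k, LinearMap.sum_apply, LinearMap.smul_apply, LinearMap.sub_apply, smul_eq_mul]
    apply Finset.sum_eq_zero
    intro t _
    field_simp
    ring
  have ko : k S.o = 0 := by
    simp only [k, LinearMap.sum_apply, LinearMap.smul_apply, LinearMap.sub_apply, smul_eq_mul]
    apply Finset.sum_eq_zero
    intro t ht
    rw [S.c_o _ hF₀ t (hτ ht), S.c_o _ hF₀ y hy]
    ring
  have kt : ∀ t ∈ τ, k (S.p t) = f t := by
    intro t ht
    have hyt : y ≠ t := fun h => hyτ (h ▸ ht)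
    simp only [k, LinearMap.sum_apply, LinearMap.smul_apply, LinearMap.sub_apply, smul_eq_mul]
    rw [Finset.sum_eq_single_of_mem t ht]
    · rw [S.c_self _ hF₀ t (hτ ht), S.c_ne _ hF₀ y hy t (hτ ht) hyt]; ring
    · intro s hs hst
      rw [S.c_ne _ hF₀ s (hτ hs) t (hτ ht) hst, S.c_ne _ hF₀ y hy t (hτ ht) hyt]; ring
  refine ⟨fun x => f x - k (S.p x), fun t ht => by simp [kt t ht], fun F hF => ?_⟩
  have := S.ev_lin (r := r) k hF
  rw [kr, ko] at this
  have h2 : S.ev r F (fun x => f x - k (S.p x)) = S.ev r F f - S.ev r F (fun x => k (S.p x)) := by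
    unfold ev
    rw [← Finset.sum_sub_distrib]
    exact Finset.sum_congr rfl (fun _ _ => by ring)
  rw [h2, this]; ring

/-- structure of the star of a ridge -/
lemma st_ridge {F : Finset ι} (hF : F ∈ S.Fs) {x x' : ι} (hx : x ∈ F) (hx' : x' ∉ F)
    (hG : insert x' (F.erase x) ∈ S.Fs) :
    S.st (F.erase x) = {F, insert x' (F.erase x)} := by
  ext H
  rw [mem_st, mem_insert, mem_singleton]
  constructor
  · rintro ⟨hH, hsub⟩
    by_cases hxH : x ∈ H
    · left
      symm
      apply Finset.eq_of_subset_of_card_le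
      · intro y hy
        by_cases h : y = x
        · exact h ▸ hxH
        · exact hsub (mem_erase.2 ⟨h, hy⟩)
      · rw [S.card_eq _ hF, S.card_eq _ hH]
    · right
      have hc : (F.erase x).card + 1 = H.card := by
        rw [Finset.card_erase_add_one hx, S.card_eq _ hF, S.card_eq _ hH]
      obtain ⟨a, ha, haH⟩ := (Finset.covBy_iff_exists_insert.1
        (Finset.covBy_iff_card_sdiff_eq_one.2 ⟨hsub, by
          rw [Finset.card_sdiff_of_subset hsub]; omega⟩))
      have haF : a ∉ F := by
        intro h
        apply ha
        apply mem_erase.2 ⟨?_, h⟩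
        rintro rfl
        exact hxH (haH ▸ mem_insert_self _ _)
      have := S.adj_unique hF hx hx' haF hG (by rw [haH]; exact hH)
      rw [← haH, this]
  · rintro (rfl | rfl)
    · exact ⟨hF, erase_subset _ _⟩
    · exact ⟨hG, subset_insert _ _⟩

lemma wt_ridge {r : W} {F : Finset ι} (hF : F ∈ S.Fs) {x : ι} (hx : x ∈ F) :
    S.wt r (F.erase x) F = (S.vol F * S.c F x r)⁻¹ := by
  unfold wt
  have : F \ F.erase x = {x} := by
    ext y; simp only [mem_sdiff, mem_erase, mem_singleton]
    constructor
    · rintro ⟨a, b⟩; by_contra h; exact b ⟨h, a⟩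
    · rintro rfl; exact ⟨hx, by simp⟩
  rw [this, prod_singleton]

/-- sum over a ridge star with weights -/
lemma ridge_sum {r : W} (hr : S.Gen r) {F : Finset ι} (hF : F ∈ S.Fs) {x : ι} (hx : x ∈ F)
    (φ : Finset ι → ℝ) : ∃ x', x' ∉ F ∧ insert x' (F.erase x) ∈ S.Fs ∧
    ∑ H ∈ S.st (F.erase x), S.wt r (F.erase x) H * φ H =
      (S.vol F * S.c F x r)⁻¹ * (φ F - φ (insert x' (F.erase x))) := by
  obtain ⟨x', hx', hG, hvol⟩ := S.adj F hF x hx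
  refine ⟨x', hx', hG, ?_⟩
  have hx'R : x' ∉ F.erase x := fun h => hx' (mem_of_mem_erase h)
  have hFG : F ≠ insert x' (F.erase x) := fun h => hx' (h ▸ mem_insert_self _ _)
  rw [S.st_ridge hF hx hx' hG, Finset.sum_pair hFG, S.wt_ridge hF hx]
  have h1 := S.wt_ridge (r := r) hG (mem_insert_self x' (F.erase x))
  rw [erase_insert hx'R] at h1
  rw [h1, hvol, abs_of_neg (S.c_neg hF hx hx' hG)]
  have h2 := S.app_ridge (S.c F x) hG (mem_insert_self x' (F.erase x)) (by
    intro y hy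
    rw [erase_insert hx'R] at hy
    exact S.c_ne _ hF x hx y (mem_of_mem_erase hy) (ne_of_mem_erase hy).symm) r
  rw [S.c_o _ hF x hx, mul_zero, add_zero] at h2
  have h3 : -S.c F x (S.p x') * S.vol F * S.c (insert x' (F.erase x)) x' r
      = - (S.vol F * S.c F x r) := by
    rw [h2]; ring
  rw [h3, inv_neg]
  ring

lemma ridge_zero {r : W} (hr : S.Gen r) {R : Finset ι} (hR : R.card + 1 = d) :
    ∑ H ∈ S.st R, S.wt r R H = 0 := by
  rcases (S.st R).eq_empty_or_nonempty with h | ⟨F, hF⟩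
  · simp [h]
  · rw [mem_st] at hF
    obtain ⟨a, ha, haF⟩ := (Finset.covBy_iff_exists_insert.1
        (Finset.covBy_iff_card_sdiff_eq_one.2 ⟨hF.2, by
          rw [Finset.card_sdiff_of_subset hF.2]; have := S.card_eq _ hF.1; omega⟩))
    obtain ⟨x', _, _, h⟩ := S.ridge_sum hr hF.1 (x := a) (haF ▸ mem_insert_self _ _) (fun _ => 1)
    have : F.erase a = R := by rw [← haF, erase_insert ha]
    rw [this] at h
    simpa using h

lemma exists_notMem {τ F : Finset ι} (hF : F ∈ S.Fs) (hc : τ.card < d) :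
    ∃ y ∈ F, y ∉ τ := by
  by_contra h
  push Not at h
  have := Finset.card_le_card (s := F) (t := τ) h
  rw [S.card_eq _ hF] at this
  omega

/-- degree one functions have degree zero in codimension two -/
lemma deg1 {r : W} (hr : S.Gen r) {σ : Finset ι} (hσ : σ.card + 2 = d) (f : ι → ℝ) :
    ∑ F ∈ S.st σ, S.wt r σ F * S.ev r F f = 0 := by
  rcases (S.st σ).eq_empty_or_nonempty with h | ⟨F, hF⟩
  · simp [h]
  · rw [mem_st] at hF
    obtain ⟨y, hy, hyσ⟩ := S.exists_notMem (τ := σ) hF.1 (by omega)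
    obtain ⟨f', h0, he⟩ := S.shift hr hF.1 hF.2 hy hyσ f
    have h1 := S.drop hr σ f' h0 (fun _ => 1)
    simp only [mul_one] at h1
    have h2 : ∑ F ∈ S.st σ, S.wt r σ F * S.ev r F f =
        ∑ F ∈ S.st σ, S.wt r σ F * S.ev r F f' :=
      Finset.sum_congr rfl (fun G hG => by rw [he G (S.mem_st.1 hG).1])
    rw [h2, h1]
    apply Finset.sum_eq_zero
    intro x hx
    rw [S.ridge_zero hr (R := insert x σ), mul_zero]
    rw [card_insert_of_notMem (mem_sdiff.1 hx).2]; omega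

lemma deg0 {r : W} (hr : S.Gen r) {σ : Finset ι} (hσ : σ.card + 2 = d) :
    ∑ F ∈ S.st σ, S.wt r σ F = 0 := by
  rcases (S.st σ).eq_empty_or_nonempty with h | ⟨F, hF⟩
  · simp [h]
  · rw [mem_st] at hF
    obtain ⟨y, hy, hyσ⟩ := S.exists_notMem (τ := σ) hF.1 (by omega)
    have h1 := S.deg1 hr hσ (fun x => S.c F y (S.p x))
    have h2 : ∀ G ∈ S.st σ, S.wt r σ G * S.ev r G (fun x => S.c F y (S.p x)) =
        S.wt r σ G * S.c F y r := by
      intro G hG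
      rw [S.ev_lin _ (S.mem_st.1 hG).1, S.c_o _ hF.1 y hy]; ring
    rw [Finset.sum_congr rfl h2, ← Finset.sum_mul] at h1
    exact (mul_eq_zero.1 h1).resolve_right (hr _ hF.1 y hy)

lemma deg2 {r : W} (hr : S.Gen r) {τ : Finset ι} (hτ : τ.card + 3 = d) (f g : ι → ℝ) :
    ∑ F ∈ S.st τ, S.wt r τ F * S.ev r F f * S.ev r F g = 0 := by
  rcases (S.st τ).eq_empty_or_nonempty with h | ⟨F, hF⟩
  · simp [h]
  · rw [mem_st] at hF
    obtain ⟨y, hy, hyτ⟩ := S.exists_notMem (τ := τ) hF.1 (by omega)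
    obtain ⟨f', h0, he⟩ := S.shift hr hF.1 hF.2 hy hyτ f
    have h1 := S.drop hr τ f' h0 (fun F => S.ev r F g)
    have h2 : ∑ F ∈ S.st τ, S.wt r τ F * S.ev r F f * S.ev r F g =
        ∑ F ∈ S.st τ, S.wt r τ F * S.ev r F f' * S.ev r F g :=
      Finset.sum_congr rfl (fun G hG => by rw [he G (S.mem_st.1 hG).1])
    rw [h2, h1]
    apply Finset.sum_eq_zero
    intro x hx
    rw [S.deg1 hr (σ := insert x τ), mul_zero]
    rw [card_insert_of_notMem (mem_sdiff.1 hx).2]; omega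

end SphData
namespace SphData

variable {ι W : Type} [AddCommGroup W] [Module ℝ W] {d : ℕ} (S : SphData ι W d)

lemma exists_erase_eq {R F : Finset ι} (hF : F ∈ S.Fs) (hR : R.card + 1 = d) (hRF : R ⊆ F) :
    ∃ a ∈ F, F.erase a = R := by
  obtain ⟨a, ha, haF⟩ := (Finset.covBy_iff_exists_insert.1
        (Finset.covBy_iff_card_sdiff_eq_one.2 ⟨hRF, by
          rw [Finset.card_sdiff_of_subset hRF]; have := S.card_eq _ hF; omega⟩))
  exact ⟨a, haF ▸ mem_insert_self _ _, by rw [← haF, erase_insert ha]⟩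

lemma l_nonneg {F G : Finset ι} (hF : F ∈ S.Fs) (hG : G ∈ S.Fs) {x : ι} (hx : x ∈ G) :
    0 ≤ S.l F (S.p x) := by
  by_cases h : x ∈ F
  · rw [S.l_zero _ hF x h]
  · exact (S.l_pos _ hF _ hG x hx h).le

lemma ridge_neg {r : W} (hr : S.Gen r) {R F : Finset ι} (hF : F ∈ S.Fs) (hR : R.card + 1 = d)
    (hRF : R ⊆ F) : ∑ H ∈ S.st R, S.wt r R H * S.l H r < 0 := by
  obtain ⟨z, hz, rfl⟩ := S.exists_erase_eq hF hR hRF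
  obtain ⟨x', hx', hG, h⟩ := S.ridge_sum hr hF hz (fun H => S.l H r)
  rw [h]
  have hne : z ≠ x' := fun h => hx' (h ▸ hz)
  have h2 := S.app_ridge (S.l (insert x' (F.erase z))) hF hz
    (fun y hy => S.l_zero _ hG y (mem_insert_of_mem hy)) r
  rw [S.l_o _ hG] at h2
  have h3 := S.l_pos _ hG _ hF z hz (by simp [hne])
  have hc := hr _ hF z hz
  have hv := S.vol_pos _ hF
  have h4 : (S.vol F * S.c F z r)⁻¹ * (S.l F r - S.l (insert x' (F.erase z)) r)
      = - (S.l (insert x' (F.erase z)) (S.p z) / S.vol F) := by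
    rw [h2]; field_simp; ring
  rw [h4]
  have := div_pos h3 hv
  linarith

lemma opt_pos {r : W} {σ F G : Finset ι} (hF : F ∈ S.st σ) (hG : G ∈ S.st σ) (hne : G ≠ F)
    (h : ∀ x ∈ F \ σ, 0 < S.c F x r) : S.l F r < S.l G r := by
  rw [mem_st] at hF hG
  have h1 := S.app (S.l G) hF.1 r
  rw [S.l_o _ hG.1, mul_one] at h1
  have : 0 < ∑ x ∈ F, S.c F x r * S.l G (S.p x) := by
    apply Finset.sum_pos'
    · intro x hx
      by_cases hxG : x ∈ G
      · rw [S.l_zero _ hG.1 x hxG, mul_zero]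
      · have := h x (mem_sdiff.2 ⟨hx, fun h => hxG (hG.2 h)⟩)
        exact (mul_pos this (S.l_pos _ hG.1 _ hF.1 x hx hxG)).le
    · have : ∃ x ∈ F, x ∉ G := by
        by_contra hh
        push Not at hh
        apply hne
        symm
        exact Finset.eq_of_subset_of_card_le hh (by rw [S.card_eq _ hF.1, S.card_eq _ hG.1])
      obtain ⟨x, hx, hxG⟩ := this
      exact ⟨x, hx, mul_pos (h x (mem_sdiff.2 ⟨hx, fun h => hxG (hG.2 h)⟩))
        (S.l_pos _ hG.1 _ hF.1 x hx hxG)⟩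
  linarith

lemma ev_neg (r : W) (x : ι) (F : Finset ι) : S.c F x (-r) = - S.c F x r := map_neg _ _

lemma opt_neg {r : W} {σ F G : Finset ι} (hF : F ∈ S.st σ) (hG : G ∈ S.st σ) (hne : G ≠ F)
    (h : ∀ x ∈ F \ σ, S.c F x r < 0) : S.l G r < S.l F r := by
  have := S.opt_pos (r := -r) hF hG hne (fun x hx => by
    rw [map_neg]; have := h x hx; linarith)
  simp only [map_neg] at this
  linarith

lemma sum_l {r : W} (hr : S.Gen r) {σ : Finset ι} (hσ : σ.card + 2 = d) :
    ∑ F ∈ S.st σ, S.wt r σ F * S.l F r = 0 := by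
  rcases (S.st σ).eq_empty_or_nonempty with h | ⟨F₀, hF₀⟩
  · simp [h]
  · rw [mem_st] at hF₀
    have h1 : ∀ F ∈ S.st σ, S.wt r σ F * S.l F r =
        S.l F₀ r * S.wt r σ F - S.wt r σ F * S.ev r F (fun x => S.l F₀ (S.p x)) := by
      intro F hF
      rw [S.ev_lin _ (S.mem_st.1 hF).1, S.l_o _ hF₀.1]; ring
    rw [Finset.sum_congr rfl h1, Finset.sum_sub_distrib, ← Finset.mul_sum, S.deg0 hr hσ,
      S.deg1 hr hσ]
    ring

lemma sum_ll {r : W} (hr : S.Gen r) {σ : Finset ι} (hσ : σ.card + 2 = d)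
    (hne : (S.st σ).Nonempty) :
    0 < ∑ F ∈ S.st σ, S.wt r σ F * S.l F r ^ 2 := by
  obtain ⟨F₀, hF₀⟩ := hne
  rw [mem_st] at hF₀
  have h1 : ∀ F ∈ S.st σ, S.wt r σ F * S.l F r ^ 2 =
      S.l F₀ r * (S.wt r σ F * S.l F r) -
        S.wt r σ F * S.ev r F (fun x => S.l F₀ (S.p x)) * S.l F r := by
    intro F hF
    rw [S.ev_lin _ (S.mem_st.1 hF).1, S.l_o _ hF₀.1]; ring
  rw [Finset.sum_congr rfl h1, Finset.sum_sub_distrib, ← Finset.mul_sum, S.sum_l hr hσ,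
    S.drop hr σ _ (fun t ht => S.l_zero _ hF₀.1 t (hF₀.2 ht)), mul_zero, zero_sub,
    ← Finset.sum_neg_distrib]
  have key : ∀ x ∈ S.U \ σ, ∀ G ∈ S.st (insert x σ),
      ∑ F ∈ S.st (insert x σ), S.wt r (insert x σ) F * S.l F r < 0 := by
    intro x hx G hG
    rw [mem_st] at hG
    refine S.ridge_neg hr hG.1 ?_ hG.2
    rw [card_insert_of_notMem (mem_sdiff.1 hx).2]; omega
  apply Finset.sum_pos'
  · intro x hx
    rcases (S.st (insert x σ)).eq_empty_or_nonempty with h | ⟨G, hG⟩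
    · simp [h]
    · have h2 := key x hx G hG
      rw [mem_st] at hG
      have h3 := S.l_nonneg hF₀.1 hG.1 (hG.2 (mem_insert_self _ _))
      nlinarith
  · obtain ⟨y, hy, hyσ⟩ := S.exists_notMem (τ := σ) hF₀.1 (by omega)
    obtain ⟨x', hx', hG, -⟩ := S.adj _ hF₀.1 y hy
    have hsub : insert x' σ ⊆ insert x' (F₀.erase y) := by
      apply insert_subset_insert
      intro t ht
      exact mem_erase.2 ⟨fun h => hyσ (h ▸ ht), hF₀.2 ht⟩
    have hxU : x' ∈ S.U \ σ := by
      rw [mem_sdiff]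
      refine ⟨?_, fun h => hx' (hF₀.2 h)⟩
      simp only [U, mem_biUnion, id]
      exact ⟨_, hG, mem_insert_self _ _⟩
    refine ⟨x', hxU, ?_⟩
    have h2 := key x' hxU _ (S.mem_st.2 ⟨hG, hsub⟩)
    have h3 := S.l_pos _ hF₀.1 _ hG x' (mem_insert_self _ _) hx'
    nlinarith

/-- at most two facets have positive weight -/
lemma two_pos {r : W} (hr : S.Gen r) {σ : Finset ι} (hσ : σ.card + 2 = d)
    (hne : (S.st σ).Nonempty) :
    ∃ F₁ ∈ S.st σ, ∃ F₂ ∈ S.st σ, ∀ F ∈ S.st σ, F ≠ F₁ → F ≠ F₂ → S.wt r σ F < 0 := by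
  obtain ⟨F₁, h1, m1⟩ := Finset.exists_min_image (S.st σ) (fun F => S.l F r) hne
  obtain ⟨F₂, h2, m2⟩ := Finset.exists_max_image (S.st σ) (fun F => S.l F r) hne
  refine ⟨F₁, h1, F₂, h2, fun F hF hF1 hF2 => ?_⟩
  have hF' := S.mem_st.1 hF
  have hc : (F \ σ).card = 2 := by
    rw [card_sdiff_of_subset hF'.2]; have := S.card_eq _ hF'.1; omega
  obtain ⟨a, b, hab, he⟩ := Finset.card_eq_two.1 hc
  have ha : a ∈ F \ σ := by simp [he]
  have hb : b ∈ F \ σ := by simp [he]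
  have ca := hr _ hF'.1 a (mem_sdiff.1 ha).1
  have cb := hr _ hF'.1 b (mem_sdiff.1 hb).1
  unfold wt
  rw [inv_lt_zero]
  apply mul_neg_of_pos_of_neg (S.vol_pos _ hF'.1)
  rw [he, prod_pair hab]
  rcases lt_or_gt_of_ne ca with ha' | ha' <;> rcases lt_or_gt_of_ne cb with hb' | hb'
  · exfalso
    have := S.opt_neg (r := r) hF h2 (Ne.symm hF2) (by
      intro x hx; rw [he] at hx; simp at hx; rcases hx with rfl | rfl <;> assumption)
    have := m2 F hF
    linarith
  · exact mul_neg_of_neg_of_pos ha' hb'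
  · exact mul_neg_of_pos_of_neg ha' hb'
  · exfalso
    have := S.opt_pos (r := r) hF h1 (Ne.symm hF1) (by
      intro x hx; rw [he] at hx; simp at hx; rcases hx with rfl | rfl <;> assumption)
    have := m1 F hF
    linarith

/-- local Hodge-Riemann -/
lemma hodge {r : W} (hr : S.Gen r) {σ : Finset ι} (hσ : σ.card + 2 = d) (φ : Finset ι → ℝ)
    (h1 : ∑ F ∈ S.st σ, S.wt r σ F * φ F = 0)
    (h2 : ∑ F ∈ S.st σ, S.wt r σ F * φ F * S.l F r = 0) :
    ∑ F ∈ S.st σ, S.wt r σ F * φ F ^ 2 ≤ 0 ∧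
    (∑ F ∈ S.st σ, S.wt r σ F * φ F ^ 2 = 0 → ∀ F ∈ S.st σ, ∀ G ∈ S.st σ, φ F = φ G) := by
  rcases (S.st σ).eq_empty_or_nonempty with h | hne
  · simp [h]
  have hll := S.sum_ll hr hσ hne
  have hl := S.sum_l hr hσ
  have h0 := S.deg0 hr hσ
  obtain ⟨F₁, hF₁, F₂, hF₂, hw⟩ := S.two_pos hr hσ hne
  have expand : ∀ t c : ℝ, ∑ F ∈ S.st σ, S.wt r σ F * (φ F - t * S.l F r - c) ^ 2 =
      ∑ F ∈ S.st σ, S.wt r σ F * φ F ^ 2 + t ^ 2 * ∑ F ∈ S.st σ, S.wt r σ F * S.l F r ^ 2 := by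
    intro t c
    have : ∀ F ∈ S.st σ, S.wt r σ F * (φ F - t * S.l F r - c) ^ 2 =
        S.wt r σ F * φ F ^ 2 + t ^ 2 * (S.wt r σ F * S.l F r ^ 2)
        + c ^ 2 * S.wt r σ F - 2 * t * (S.wt r σ F * φ F * S.l F r)
        - 2 * c * (S.wt r σ F * φ F) + 2 * t * c * (S.wt r σ F * S.l F r) := by
      intro F _; ring
    rw [Finset.sum_congr rfl this]
    simp only [Finset.sum_add_distrib, Finset.sum_sub_distrib, ← Finset.mul_sum]
    rw [h1, h2, hl, h0]; ring
  have nonpos : ∀ t c : ℝ, φ F₁ - t * S.l F₁ r - c = 0 → φ F₂ - t * S.l F₂ r - c = 0 →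
      ∀ F ∈ S.st σ, S.wt r σ F * (φ F - t * S.l F r - c) ^ 2 ≤ 0 := by
    intro t c e1 e2 F hF
    by_cases hF1 : F = F₁
    · rw [hF1, e1]; simp
    by_cases hF2 : F = F₂
    · rw [hF2, e2]; simp
    exact mul_nonpos_of_nonpos_of_nonneg (hw F hF hF1 hF2).le (sq_nonneg _)
  have hl12 : S.l F₁ r ≠ S.l F₂ r := by
    intro heq
    have : ∑ F ∈ S.st σ, S.wt r σ F * (S.l F r - S.l F₁ r) ^ 2 ≤ 0 := by
      apply Finset.sum_nonpos
      intro F hF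
      by_cases hF1 : F = F₁
      · rw [hF1]; simp
      by_cases hF2 : F = F₂
      · rw [hF2, heq]; simp
      exact mul_nonpos_of_nonpos_of_nonneg (hw F hF hF1 hF2).le (sq_nonneg _)
    have e : ∀ F ∈ S.st σ, S.wt r σ F * (S.l F r - S.l F₁ r) ^ 2 =
        S.wt r σ F * S.l F r ^ 2 - 2 * S.l F₁ r * (S.wt r σ F * S.l F r)
        + S.l F₁ r ^ 2 * S.wt r σ F := by intro F _; ring
    rw [Finset.sum_congr rfl e] at this
    simp only [Finset.sum_add_distrib, Finset.sum_sub_distrib, ← Finset.mul_sum] at this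
    rw [hl, h0] at this
    linarith
  have hsub : S.l F₁ r - S.l F₂ r ≠ 0 := sub_ne_zero.2 hl12
  obtain ⟨t, ht⟩ : ∃ t, t = (φ F₁ - φ F₂) / (S.l F₁ r - S.l F₂ r) := ⟨_, rfl⟩
  obtain ⟨c, hc⟩ : ∃ c, c = φ F₁ - t * S.l F₁ r := ⟨_, rfl⟩
  have e1 : φ F₁ - t * S.l F₁ r - c = 0 := by rw [hc]; ring
  have e2 : φ F₂ - t * S.l F₂ r - c = 0 := by
    rw [hc]
    have : t * (S.l F₁ r - S.l F₂ r) = φ F₁ - φ F₂ := by rw [ht]; field_simp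
    linarith
  have hn := nonpos t c e1 e2
  have hs := Finset.sum_nonpos hn
  have hs' := hs
  rw [expand] at hs
  have ht2 := mul_nonneg (sq_nonneg t) hll.le
  refine ⟨by linarith, fun hz => ?_⟩
  have ht0 : t = 0 := by
    rw [hz, zero_add] at hs
    have : t ^ 2 * ∑ F ∈ S.st σ, S.wt r σ F * S.l F r ^ 2 = 0 := le_antisymm hs ht2
    rcases mul_eq_zero.1 this with h | h
    · exact pow_eq_zero_iff (two_ne_zero) |>.1 h
    · linarith
  have hsz : ∑ F ∈ S.st σ, S.wt r σ F * (φ F - t * S.l F r - c) ^ 2 = 0 := by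
    rw [expand, hz, ht0]; ring
  have hall := (Finset.sum_eq_zero_iff_of_nonpos hn).1 hsz
  have hc' : ∀ F ∈ S.st σ, φ F = c := by
    intro F hF
    have := (mul_eq_zero.1 (hall F hF)).resolve_left (S.wt_ne hr (S.mem_st.1 hF).1)
    have := pow_eq_zero_iff (two_ne_zero) |>.1 this
    rw [ht0] at this
    linarith
  intro F hF G hG
  rw [hc' F hF, hc' G hG]

def Mot (w : ι) (M : ι → W →ₗ[ℝ] ℝ) : Prop :=
  ∀ F ∈ S.Fs, w ∈ F → ∀ x ∈ F, ∀ y ∈ F, M x (S.p y) + M y (S.p x) = 0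

lemma mot_ev {w : ι} {M : ι → W →ₗ[ℝ] ℝ} (hM : S.Mot w M) {F : Finset ι} (hF : F ∈ S.Fs)
    (hw : w ∈ F) (r : W) :
    S.ev r F (fun x => M x r) = S.l F r * S.ev r F (fun x => M x S.o) := by
  have h0 : ∑ x ∈ F, ∑ y ∈ F, S.c F x r * (S.c F y r * M x (S.p y)) = 0 := by
    have h1 : ∑ x ∈ F, ∑ y ∈ F, S.c F x r * (S.c F y r * M x (S.p y)) =
        ∑ x ∈ F, ∑ y ∈ F, S.c F x r * (S.c F y r * M y (S.p x)) := by
      rw [Finset.sum_comm]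
      apply Finset.sum_congr rfl; intro x _
      apply Finset.sum_congr rfl; intro y _
      ring
    have h2 : ∑ x ∈ F, ∑ y ∈ F, S.c F x r * (S.c F y r * M x (S.p y)) +
        ∑ x ∈ F, ∑ y ∈ F, S.c F x r * (S.c F y r * M y (S.p x)) = 0 := by
      rw [← Finset.sum_add_distrib]
      apply Finset.sum_eq_zero; intro x hx
      rw [← Finset.sum_add_distrib]
      apply Finset.sum_eq_zero; intro y hy
      rw [← mul_add, ← mul_add, hM F hF hw x hx y hy]; ring
    linarith
  unfold ev
  have h3 : ∀ x ∈ F, S.c F x r * M x r = ∑ y ∈ F, S.c F x r * (S.c F y r * M x (S.p y)) +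
      S.l F r * (S.c F x r * M x S.o) := by
    intro x _
    rw [S.app (M x) hF r, ← Finset.mul_sum]; ring
  rw [Finset.sum_congr rfl h3, Finset.sum_add_distrib, h0, ← Finset.mul_sum]; ring

/-- The global argument: piecewise linear function is locally linear. -/
lemma flat {r : W} (hr : S.Gen r) {w : ι} {M : ι → W →ₗ[ℝ] ℝ} (hM : S.Mot w M)
    {σ : Finset ι} (hσ : σ.card + 2 = d) (hwσ : w ∈ σ) {x : ι} (hx : x ∈ σ) (hxw : x ≠ w)
    {F G : Finset ι} (hF : F ∈ S.st σ) (hG : G ∈ S.st σ) :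
    S.ev r F (fun x => M x S.o) = S.ev r G (fun x => M x S.o) := by
  obtain ⟨g, hg⟩ : ∃ g : ι → ℝ, g = fun x => M x S.o := ⟨_, rfl⟩
  obtain ⟨N, hN⟩ : ∃ N : ι → ℝ, N = fun x => M x r := ⟨_, rfl⟩
  rw [← hg]
  have hgN : ∀ F ∈ S.Fs, w ∈ F → S.ev r F N = S.l F r * S.ev r F g := by
    intro F hF hw
    rw [hg, hN]; exact S.mot_ev hM hF hw r
  have loc : ∀ ρ : Finset ι, ρ.card + 2 = d → w ∈ ρ →
      ∑ F ∈ S.st ρ, S.wt r ρ F * S.ev r F g ^ 2 ≤ 0 ∧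
      (∑ F ∈ S.st ρ, S.wt r ρ F * S.ev r F g ^ 2 = 0 →
        ∀ F ∈ S.st ρ, ∀ G ∈ S.st ρ, S.ev r F g = S.ev r G g) := by
    intro ρ hρ hwρ
    apply S.hodge hr hρ (fun F => S.ev r F g) (S.deg1 hr hρ g)
    rw [← S.deg1 hr hρ N]
    apply Finset.sum_congr rfl
    intro H hH
    rw [mem_st] at hH
    rw [hgN H hH.1 (hH.2 hwρ)]; ring
  refine (loc σ hσ hwσ).2 ?_ F hF G hG
  -- choose a facet containing `τ` but not `x`
  have hF' := S.mem_st.1 hF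
  obtain ⟨x', hx', hF₀, -⟩ := S.adj F hF'.1 x (hF'.2 hx)
  set F₀ := insert x' (F.erase x) with hF₀def
  have hxF₀ : x ∉ F₀ := by
    have : x ≠ x' := fun h => hx' (h ▸ hF'.2 hx)
    simp [hF₀def, this]
  set τ := σ.erase x with hτdef
  have hτF₀ : τ ⊆ F₀ := (erase_subset_erase x hF'.2).trans (subset_insert _ _)
  have hτ : τ.card + 3 = d := by
    have := card_erase_add_one hx
    rw [hτdef]; omega
  have hwτ : w ∈ τ := mem_erase.2 ⟨Ne.symm hxw, hwσ⟩
  have tot : ∑ H ∈ S.st τ, S.wt r τ H * S.ev r H (fun x => S.l F₀ (S.p x)) * S.ev r H g ^ 2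
      = 0 := by
    have e : ∀ H ∈ S.st τ,
        S.wt r τ H * S.ev r H (fun x => S.l F₀ (S.p x)) * S.ev r H g ^ 2 =
        S.l F₀ r * (S.wt r τ H * S.ev r H g * S.ev r H g)
          - S.wt r τ H * S.ev r H N * S.ev r H g := by
      intro H hH
      rw [mem_st] at hH
      rw [hgN H hH.1 (hH.2 hwτ), S.ev_lin _ hH.1, S.l_o _ hF₀]; ring
    rw [Finset.sum_congr rfl e, Finset.sum_sub_distrib, ← Finset.mul_sum, S.deg2 hr hτ,
      S.deg2 hr hτ]
    ring
  rw [S.drop hr τ _ (fun t ht => S.l_zero _ hF₀ t (hτF₀ ht))] at tot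
  have hterm : ∀ y ∈ S.U \ τ, S.l F₀ (S.p y) *
      ∑ H ∈ S.st (insert y τ), S.wt r (insert y τ) H * S.ev r H g ^ 2 ≤ 0 := by
    intro y hy
    rw [mem_sdiff] at hy
    have hyU := hy.1
    simp only [U, mem_biUnion, id] at hyU
    obtain ⟨H, hH, hyH⟩ := hyU
    apply mul_nonpos_of_nonneg_of_nonpos (S.l_nonneg hF₀ hH hyH)
    refine (loc _ ?_ (mem_insert_of_mem hwτ)).1
    rw [card_insert_of_notMem hy.2]; omega
  have hxU : x ∈ S.U \ τ := by
    rw [mem_sdiff]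
    refine ⟨?_, by simp [hτdef]⟩
    simp only [U, mem_biUnion, id]
    exact ⟨F, hF'.1, hF'.2 hx⟩
  have := (Finset.sum_eq_zero_iff_of_nonpos hterm).1 tot x hxU
  have h5 := S.l_pos _ hF₀ _ hF'.1 x (hF'.2 hx) hxF₀
  have h6 := (mul_eq_zero.1 this).resolve_left h5.ne'
  rwa [hτdef, insert_erase hx] at h6

/-- the skew form attached to a facet -/
def form (M : ι → W →ₗ[ℝ] ℝ) (F : Finset ι) : W →ₗ[ℝ] W →ₗ[ℝ] ℝ :=
  ∑ x ∈ F, (S.c F x).smulRight (M x) - (S.l F).smulRight (∑ x ∈ F, (M x S.o) • S.c F x)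

lemma form_apply (M : ι → W →ₗ[ℝ] ℝ) (F : Finset ι) (a b : W) :
    S.form M F a b = ∑ x ∈ F, S.c F x a * M x b - S.l F a * ∑ x ∈ F, M x S.o * S.c F x b := by
  simp [form, LinearMap.sum_apply]

lemma form_self {w : ι} {M : ι → W →ₗ[ℝ] ℝ} (hM : S.Mot w M) {F : Finset ι} (hF : F ∈ S.Fs)
    (hw : w ∈ F) (a : W) : S.form M F a a = 0 := by
  rw [form_apply]
  have := S.mot_ev hM hF hw a
  unfold ev at this
  rw [this, sub_eq_zero]
  congr 1
  exact Finset.sum_congr rfl (fun _ _ => mul_comm _ _)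

lemma form_vert (M : ι → W →ₗ[ℝ] ℝ) {F : Finset ι} (hF : F ∈ S.Fs) {x : ι} (hx : x ∈ F)
    (b : W) : S.form M F (S.p x) b = M x b := by
  rw [form_apply, S.l_zero _ hF x hx, Finset.sum_eq_single_of_mem x hx, S.c_self _ hF x hx]
  · ring
  · intro y hy hyx
    rw [S.c_ne _ hF y hy x hx hyx, zero_mul]

lemma form_o (M : ι → W →ₗ[ℝ] ℝ) {F : Finset ι} (hF : F ∈ S.Fs)
    (b : W) : S.form M F S.o b = - S.ev b F (fun x => M x S.o) := by
  rw [form_apply, S.l_o _ hF, Finset.sum_eq_zero]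
  · unfold ev
    rw [zero_sub, one_mul]
    congr 1
    exact Finset.sum_congr rfl (fun _ _ => mul_comm _ _)
  · intro y hy
    rw [S.c_o _ hF y hy, zero_mul]

lemma skew_of_self {B : W →ₗ[ℝ] W →ₗ[ℝ] ℝ} (h : ∀ a, B a a = 0) (a b : W) :
    B a b = - B b a := by
  have := h (a + b)
  simp only [map_add, LinearMap.add_apply, h] at this
  linarith

lemma kill {r : W} (hr : S.Gen r) {F : Finset ι} (hF : F ∈ S.Fs) {x : ι} (hx : x ∈ F)
    (k : W →ₗ[ℝ] ℝ) (h1 : ∀ y ∈ F.erase x, k (S.p y) = 0) (h2 : k S.o = 0) (h3 : k r = 0)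
    (a : W) : k a = 0 := by
  have e := S.app_ridge k hF hx h1 r
  rw [h2, h3, mul_zero, add_zero] at e
  have := (mul_eq_zero.1 e.symm).resolve_left (hr _ hF x hx)
  rw [S.app_ridge k hF hx h1 a, this, h2]; ring

lemma form_adj {r : W} (hr : S.Gen r) (hd : 4 ≤ d) {w : ι} {M : ι → W →ₗ[ℝ] ℝ}
    (hM : S.Mot w M)
    {F : Finset ι} (hF : F ∈ S.Fs) (hw : w ∈ F) {x x' : ι} (hx : x ∈ F) (hxw : x ≠ w)
    (hG : insert x' (F.erase x) ∈ S.Fs) :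
    S.form M F = S.form M (insert x' (F.erase x)) := by
  set G := insert x' (F.erase x) with hGdef
  have hsub : F.erase x ⊆ G := subset_insert _ _
  have hwR : w ∈ F.erase x := mem_erase.2 ⟨Ne.symm hxw, hw⟩
  have hwG := hsub hwR
  have hcR := card_erase_add_one hx
  rw [S.card_eq _ hF] at hcR
  have hcR1 := card_erase_add_one hwR
  obtain ⟨a, b, ha, hb, hab⟩ := Finset.one_lt_card_iff.1
    (show 1 < ((F.erase x).erase w).card by omega)
  rw [mem_erase] at ha hb
  have hca := card_erase_add_one ha.2
  have hflat := S.flat hr hM (σ := (F.erase x).erase a) (by omega)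
    (mem_erase.2 ⟨Ne.symm ha.1, hwR⟩) (x := b) (mem_erase.2 ⟨Ne.symm hab, hb.2⟩) hb.1
    (F := F) (G := G) (S.mem_st.2 ⟨hF, (erase_subset _ _).trans (erase_subset _ _)⟩)
    (S.mem_st.2 ⟨hG, (erase_subset _ _).trans hsub⟩)
  have hself : ∀ a, (S.form M F - S.form M G) a a = 0 := by
    intro a
    simp [S.form_self hM hF hw, S.form_self hM hG hwG]
  have hsk := skew_of_self hself
  have hR : ∀ y ∈ F.erase x, ∀ b, (S.form M F - S.form M G) (S.p y) b = 0 := by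
    intro y hy b
    simp [S.form_vert M hF (mem_of_mem_erase hy), S.form_vert M hG (hsub hy)]
  have ho : ∀ b, (S.form M F - S.form M G) S.o b = 0 := by
    apply S.kill hr hF hx
    · intro y hy; rw [hsk, hR y hy, neg_zero]
    · exact hself _
    · simp [S.form_o M hF, S.form_o M hG, hflat]
  have hrr : ∀ b, (S.form M F - S.form M G) r b = 0 := by
    apply S.kill hr hF hx
    · intro y hy; rw [hsk, hR y hy, neg_zero]
    · rw [hsk, ho, neg_zero]
    · exact hself _
  rw [← sub_eq_zero]
  apply LinearMap.ext; intro a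
  apply LinearMap.ext; intro b
  change (S.form M F - S.form M G) a b = 0
  rw [hsk, neg_eq_zero]
  apply S.kill hr hF hx
  · intro y hy; rw [hsk, hR y hy, neg_zero]
  · rw [hsk, ho, neg_zero]
  · rw [hsk, hrr, neg_zero]

lemma form_const {r : W} (hr : S.Gen r) (hd : 4 ≤ d) {w : ι} {M : ι → W →ₗ[ℝ] ℝ}
    (hM : S.Mot w M) {F G : Finset ι} (hF : F ∈ S.Fs) (hwF : w ∈ F) (hG : G ∈ S.Fs)
    (hwG : w ∈ G) : S.form M F = S.form M G := by
  have memst : ∀ H, H ∈ S.st {w} ↔ H ∈ S.Fs ∧ w ∈ H := by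
    intro H; rw [mem_st, singleton_subset_iff]
  obtain ⟨F₁, h1, m1⟩ := Finset.exists_min_image (S.st {w}) (fun F => S.l F r)
    ⟨F, (memst F).2 ⟨hF, hwF⟩⟩
  suffices h : ∀ H ∈ S.st {w}, S.form M H = S.form M F₁ by
    rw [h F ((memst F).2 ⟨hF, hwF⟩), h G ((memst G).2 ⟨hG, hwG⟩)]
  by_contra hcon
  push Not at hcon
  obtain ⟨H₀, hH₀, hne₀⟩ := hcon
  obtain ⟨H, hH, mH⟩ := Finset.exists_min_image
    ((S.st {w}).filter (fun H => S.form M H ≠ S.form M F₁)) (fun F => S.l F r)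
    ⟨H₀, mem_filter.2 ⟨hH₀, hne₀⟩⟩
  rw [mem_filter] at hH
  obtain ⟨hH, hne⟩ := hH
  have hH' := (memst H).1 hH
  by_cases hall : ∀ x ∈ H \ {w}, 0 < S.c H x r
  · have hF₁H : F₁ ≠ H := fun h => hne (by rw [h])
    have := S.opt_pos hH h1 hF₁H hall
    have := m1 H hH
    linarith
  · push Not at hall
    obtain ⟨x, hx, hcx⟩ := hall
    rw [mem_sdiff, mem_singleton] at hx
    have hcx' : S.c H x r < 0 := lt_of_le_of_ne hcx (hr _ hH'.1 x hx.1)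
    obtain ⟨x', hx', hK, -⟩ := S.adj H hH'.1 x hx.1
    have hfa := S.form_adj hr hd hM hH'.1 hH'.2 hx.1 hx.2 hK
    have hwK : w ∈ insert x' (H.erase x) :=
      mem_insert_of_mem (mem_erase.2 ⟨Ne.symm hx.2, hH'.2⟩)
    have h2 := mH _ (mem_filter.2 ⟨(memst _).2 ⟨hK, hwK⟩, by rw [← hfa]; exact hne⟩)
    have hne' : x ≠ x' := fun h => hx' (h ▸ hx.1)
    have h3 := S.app_ridge (S.l (insert x' (H.erase x))) hH'.1 hx.1
      (fun y hy => S.l_zero _ hK y (mem_insert_of_mem hy)) r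
    rw [S.l_o _ hK] at h3
    have h4 := S.l_pos _ hK _ hH'.1 x hx.1 (by simp [hne'])
    nlinarith

/-- final abstract statement -/
lemma main {r : W} (hr : S.Gen r) (hd : 4 ≤ d) {w z u v : ι} {M : ι → W →ₗ[ℝ] ℝ}
    (hMw : S.Mot w M) (hMz : S.Mot z M)
    (hwz : ∃ F ∈ S.Fs, w ∈ F ∧ z ∈ F) (hvw : ∃ F ∈ S.Fs, v ∈ F ∧ w ∈ F)
    (hzu : ∃ F ∈ S.Fs, z ∈ F ∧ u ∈ F) : M u (S.p v) + M v (S.p u) = 0 := by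
  obtain ⟨A, hA, hwA, hzA⟩ := hwz
  obtain ⟨B, hB, hvB, hwB⟩ := hvw
  obtain ⟨C, hC, hzC, huC⟩ := hzu
  have e1 := S.form_const hr hd hMw hA hwA hB hwB
  have e2 := S.form_const hr hd hMz hA hzA hC hzC
  have h1 := S.form_vert M hB hvB (S.p u)
  have h2 := S.form_vert M hC huC (S.p v)
  rw [← e1] at h1
  rw [← e2] at h2
  rw [← h1, ← h2, skew_of_self (S.form_self hMw hA hwA)]
  ring

end SphData

namespace SPC
variable {d : ℕ}

/-- The lift of a point to the hyperplane at height one. -/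
def lift (x : Fin d → ℝ) : (Fin d → ℝ) × ℝ := (x, 1)

lemma lift_inj {x y : Fin d → ℝ} (h : lift x = lift y) : x = y := (Prod.mk.inj h).1

lemma k_zero (P : SPolytope d) (k : ((Fin d → ℝ) × ℝ) →ₗ[ℝ] ℝ)
    (h : ∀ v ∈ P.V, k (lift v) = 0) : k = 0 := by
  have key : ∀ x : Fin d → ℝ, k (x, 1) = 0 := by
    intro x
    have hx : x ∈ affineSpan ℝ (P.V : Set (Fin d → ℝ)) := by rw [P.span_top]; trivial
    refine affineSpan_induction (p := fun x => k (x, 1) = 0) hx (fun y hy => h y hy) ?_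
    · intro c a b e ha hb he
      show k (c • (a -ᵥ b) +ᵥ e, 1) = 0
      have : ((c • (a -ᵥ b) +ᵥ e, 1) : (Fin d → ℝ) × ℝ) = c • ((a, 1) - (b, 1)) + (e, 1) := by
        ext <;> simp
      rw [this, map_add, map_smul, map_sub, ha, hb, he]; simp
  have k0 : k ((0 : Fin d → ℝ), (1 : ℝ)) = 0 := key 0
  apply LinearMap.ext
  rintro ⟨x, s⟩
  have : ((x, s) : (Fin d → ℝ) × ℝ) = (x, 1) + (s - 1) • ((0 : Fin d → ℝ), (1 : ℝ)) := by
    ext <;> simp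
  rw [this, map_add, map_smul, key, k0]; simp

/-- Supporting functionals. -/
def Supp (P : SPolytope d) (l : ((Fin d → ℝ) × ℝ) →ₗ[ℝ] ℝ) : Prop :=
  l ≠ 0 ∧ ∀ v ∈ P.V, 0 ≤ l (lift v)

/-- Vertices on the supporting hyperplane. -/
def Z (P : SPolytope d) (l : ((Fin d → ℝ) × ℝ) →ₗ[ℝ] ℝ) : Finset (Fin d → ℝ) :=
  P.V.filter (fun v => l (lift v) = 0)

lemma mem_Z {P : SPolytope d} {l} {x : Fin d → ℝ} : x ∈ Z P l ↔ x ∈ P.V ∧ l (lift x) = 0 := by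
  simp [Z]

/-- The sum of all lifted vertices. -/
def oo (P : SPolytope d) : (Fin d → ℝ) × ℝ := ∑ v ∈ P.V, lift v

lemma Supp.exists_pos {P : SPolytope d} {l} (hl : Supp P l) : ∃ v ∈ P.V, 0 < l (lift v) := by
  by_contra hc
  push Not at hc
  exact hl.1 (k_zero P l fun v hv => le_antisymm (hc v hv) (hl.2 v hv))

lemma Supp.o_pos {P : SPolytope d} {l} (hl : Supp P l) : 0 < l (oo P) := by
  obtain ⟨v, hv, hp⟩ := hl.exists_pos
  rw [oo, map_sum]
  exact sum_pos' hl.2 ⟨v, hv, hp⟩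

/-- The face exposed by a supporting functional. -/
def face (P : SPolytope d) (l : ((Fin d → ℝ) × ℝ) →ₗ[ℝ] ℝ) : Set (Fin d → ℝ) :=
  {y ∈ polyBody P.V | (-(l ∘ₗ LinearMap.inl ℝ (Fin d → ℝ) ℝ)) y = l (0, 1)}

lemma split_l (l : ((Fin d → ℝ) × ℝ) →ₗ[ℝ] ℝ) (x : Fin d → ℝ) :
    l (lift x) = l (x, 0) + l (0, 1) := by
  rw [← map_add]; simp [lift]

lemma mem_face {P : SPolytope d} {l} {y : Fin d → ℝ} :
    y ∈ face P l ↔ y ∈ polyBody P.V ∧ l (lift y) = 0 := by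
  simp only [face, Set.mem_ofPred_eq, split_l, LinearMap.neg_apply, LinearMap.comp_apply,
    LinearMap.inl_apply]
  constructor
  · rintro ⟨a, b⟩; exact ⟨a, by linarith⟩
  · rintro ⟨a, b⟩; exact ⟨a, by linarith⟩

lemma V_sub {P : SPolytope d} {x : Fin d → ℝ} (h : x ∈ P.V) : x ∈ polyBody P.V :=
  subset_convexHull ℝ _ h

lemma Supp.proper {P : SPolytope d} {l} (hl : Supp P l) : IsProperFace P.V (face P l) := by
  refine ⟨⟨_, _, ?_, rfl⟩, ?_⟩
  · have : polyBody P.V ⊆ {y | (-(l ∘ₗ LinearMap.inl ℝ (Fin d → ℝ) ℝ)) y ≤ l (0, 1)} := by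
      apply convexHull_min
      · intro x hx
        have := hl.2 x hx
        rw [split_l] at this
        simp only [Set.mem_ofPred_eq, LinearMap.neg_apply, LinearMap.comp_apply,
          LinearMap.inl_apply]
        linarith
      · exact convex_halfSpace_le (LinearMap.isLinear _) _
    exact this
  · intro h
    obtain ⟨v, hv, hp⟩ := hl.exists_pos
    have : v ∈ face P l := by rw [h]; exact V_sub hv
    rw [mem_face] at this
    linarith [this.2]

lemma Supp.bface {P : SPolytope d} {l} (hl : Supp P l) {s : Finset (Fin d → ℝ)}
    (hs : s ⊆ Z P l) : BFace P s := by
  refine ⟨fun x hx => (mem_Z.1 (hs hx)).1, face P l, hl.proper, ?_⟩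
  intro x hx
  have := mem_Z.1 (hs hx)
  exact mem_face.2 ⟨V_sub this.1, this.2⟩

lemma Supp.li {P : SPolytope d} {l} (hl : Supp P l) :
    LinearIndependent ℝ (fun x : Z P l => lift (x : Fin d → ℝ)) := by
  have h := (P.simplicial _ hl.proper).1
  let f : Z P l ↪ {y : Fin d → ℝ // y ∈ (P.V : Set (Fin d → ℝ)) ∩ face P l} :=
    ⟨fun x => ⟨x.1, (mem_Z.1 x.2).1, mem_face.2 ⟨V_sub (mem_Z.1 x.2).1, (mem_Z.1 x.2).2⟩⟩, by
      intro a b hab; exact Subtype.ext (Subtype.mk.inj hab)⟩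
  have h2 := h.comp_embedding f
  rw [affineIndependent_iff] at h2
  rw [linearIndependent_iff']
  intro s g hg i hi
  refine h2 s g ?_ ?_ i hi
  · have := congrArg Prod.snd hg
    simpa [Prod.snd_sum, lift] using this
  · have := congrArg Prod.fst hg
    simp only [Prod.fst_sum, lift, Prod.smul_mk, Prod.fst_zero] at this
    exact this

lemma Supp.li_opt {P : SPolytope d} {l} (hl : Supp P l) :
    LinearIndependent ℝ
      (fun i : Option (Z P l) => i.elim (oo P) (fun x => lift (x : Fin d → ℝ))) := by
  rw [linearIndependent_option]
  refine ⟨hl.li, ?_⟩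
  intro h
  have h2 : Submodule.span ℝ (Set.range ((fun i : Option (Z P l) => i.elim (oo P)
      (fun x => lift (x : Fin d → ℝ))) ∘ some)) ≤ LinearMap.ker l := by
    rw [Submodule.span_le]
    rintro _ ⟨x, rfl⟩
    exact (mem_Z.1 x.2).2
  have := h2 h
  have h3 := hl.o_pos
  simp only [LinearMap.mem_ker, Option.elim] at this
  linarith

lemma finrankW : Module.finrank ℝ ((Fin d → ℝ) × ℝ) = d + 1 := by simp

lemma Supp.card_le {P : SPolytope d} {l} (hl : Supp P l) : (Z P l).card ≤ d := by
  have := hl.li_opt.fintype_card_le_finrank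
  rw [finrankW] at this
  simpa using this

/-- Rotating a supporting functional. -/
lemma Supp.rotate {P : SPolytope d} {l} (hl : Supp P l) (k : ((Fin d → ℝ) × ℝ) →ₗ[ℝ] ℝ)
    (hk : ∀ v ∈ Z P l, 0 ≤ k (lift v)) :
    ∃ t : ℝ, (∀ v ∈ P.V, 0 ≤ (k + t • l) (lift v)) ∧
      ∃ y ∈ P.V, y ∉ Z P l ∧ (k + t • l) (lift y) = 0 := by
  have hne : (P.V \ Z P l).Nonempty := by
    obtain ⟨v, hv, hp⟩ := hl.exists_pos
    exact ⟨v, mem_sdiff.2 ⟨hv, fun h => by linarith [(mem_Z.1 h).2]⟩⟩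
  obtain ⟨y, hy, hmax⟩ := exists_max_image (P.V \ Z P l) (fun v => - k (lift v) / l (lift v)) hne
  have hpos : ∀ v ∈ P.V \ Z P l, 0 < l (lift v) := by
    intro v hv
    obtain ⟨h1, h2⟩ := mem_sdiff.1 hv
    exact lt_of_le_of_ne (hl.2 v h1) fun h => h2 (mem_Z.2 ⟨h1, h.symm⟩)
  refine ⟨- k (lift y) / l (lift y), ?_, y, (mem_sdiff.1 hy).1, (mem_sdiff.1 hy).2, ?_⟩
  · intro v hv
    simp only [LinearMap.add_apply, LinearMap.smul_apply, smul_eq_mul]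
    by_cases hz : v ∈ Z P l
    · rw [(mem_Z.1 hz).2]; simpa using hk v hz
    · have h1 := hmax v (mem_sdiff.2 ⟨hv, hz⟩)
      have h2 := hpos v (mem_sdiff.2 ⟨hv, hz⟩)
      rw [div_le_iff₀ h2] at h1
      linarith
  · have h2 := hpos y hy
    simp only [LinearMap.add_apply, LinearMap.smul_apply, smul_eq_mul]
    field_simp
    ring

/-- Every supporting functional can be improved to a facet. -/
lemma Supp.exists_facet {P : SPolytope d} (n : ℕ) : ∀ {l}, Supp P l → d - (Z P l).card = n →
    ∃ l', Supp P l' ∧ Z P l ⊆ Z P l' ∧ (Z P l').card = d := by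
  induction n using Nat.strong_induction_on with
  | _ n ih =>
    intro l hl hn
    by_cases hc : (Z P l).card = d
    · exact ⟨l, hl, Subset.rfl, hc⟩
    have hlt : (Z P l).card < d := lt_of_le_of_ne hl.card_le hc
    obtain ⟨y, hy, hyp⟩ := hl.exists_pos
    have hyZ : y ∉ Z P l := fun h => by linarith [(mem_Z.1 h).2]
    let T : Finset ((Fin d → ℝ) × ℝ) := (insert y (Z P l)).image lift
    have hT : Submodule.span ℝ (T : Set ((Fin d → ℝ) × ℝ)) < ⊤ := by
      apply Submodule.lt_top_of_finrank_lt_finrank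
      rw [finrankW]
      calc _ ≤ T.card := finrank_span_finset_le_card T
        _ ≤ (insert y (Z P l)).card := card_image_le
        _ ≤ (Z P l).card + 1 := card_insert_le _ _
        _ < d + 1 := by omega
    obtain ⟨k, hk0, hk⟩ := Submodule.exists_le_ker_of_lt_top _ hT
    have hkT : ∀ x ∈ insert y (Z P l), k (lift x) = 0 := fun x hx =>
      hk (Submodule.subset_span (mem_coe.2 (mem_image_of_mem lift hx)))
    obtain ⟨t, ht, y0, hy0, hy0Z, hy00⟩ := hl.rotate k
      (fun v hv => (hkT v (mem_insert_of_mem hv)).ge)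
    have hne : k + t • l ≠ 0 := by
      intro h
      have h1 := LinearMap.congr_fun h (lift y)
      simp only [LinearMap.add_apply, LinearMap.smul_apply, smul_eq_mul, LinearMap.zero_apply,
        hkT y (mem_insert_self _ _), zero_add] at h1
      have : t = 0 := by
        rcases mul_eq_zero.1 h1 with h | h
        · exact h
        · linarith
      rw [this] at h
      exact hk0 (by simpa using h)
    have hs : Supp P (k + t • l) := ⟨hne, ht⟩
    have hsub : insert y0 (Z P l) ⊆ Z P (k + t • l) := by
      intro x hx
      rcases mem_insert.1 hx with rfl | hx
      · exact mem_Z.2 ⟨hy0, hy00⟩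
      · refine mem_Z.2 ⟨(mem_Z.1 hx).1, ?_⟩
        simp [hkT x (mem_insert_of_mem hx), (mem_Z.1 hx).2]
    have hcard := card_le_card hsub
    rw [card_insert_of_notMem hy0Z] at hcard
    obtain ⟨l', h1, h2, h3⟩ := ih (d - (Z P (k + t • l)).card) (by omega) hs rfl
    exact ⟨l', h1, (subset_insert _ _).trans (hsub.trans h2), h3⟩

/-- The facets. -/
def Fcts (P : SPolytope d) : Finset (Finset (Fin d → ℝ)) :=
  P.V.powerset.filter fun F => F.card = d ∧ ∃ l, Supp P l ∧ F = Z P l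

lemma mem_Fcts {P : SPolytope d} {F} : F ∈ Fcts P ↔ F.card = d ∧ ∃ l, Supp P l ∧ F = Z P l := by
  simp only [Fcts, mem_filter, mem_powerset, and_iff_right_iff_imp]
  rintro ⟨-, l, -, rfl⟩
  exact filter_subset _ _

lemma bface_facet {P : SPolytope d} {s} (h : BFace P s) : ∃ F ∈ Fcts P, s ⊆ F := by
  obtain ⟨hs, F, ⟨⟨f, c, h1, rfl⟩, h2⟩, h3⟩ := h
  let l : ((Fin d → ℝ) × ℝ) →ₗ[ℝ] ℝ :=
    c • LinearMap.snd ℝ (Fin d → ℝ) ℝ - f ∘ₗ LinearMap.fst ℝ (Fin d → ℝ) ℝ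
  have hl : ∀ x, l (lift x) = c - f x := by intro x; simp [l, lift]
  have hsupp : Supp P l := by
    constructor
    · intro h
      apply h2
      ext y
      simp only [Set.mem_ofPred_eq, and_iff_left_iff_imp]
      intro _
      have := hl y
      rw [h] at this
      simp only [LinearMap.zero_apply] at this
      linarith
    · intro v hv
      rw [hl]
      linarith [h1 v (V_sub hv)]
  obtain ⟨l', h4, h5, h6⟩ := Supp.exists_facet _ hsupp rfl
  refine ⟨Z P l', mem_Fcts.2 ⟨h6, l', h4, rfl⟩, fun x hx => h5 (mem_Z.2 ⟨hs hx, ?_⟩)⟩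
  rw [hl]
  linarith [(h3 (mem_coe.2 hx)).2]

lemma facet_bface {P : SPolytope d} {F s} (hF : F ∈ Fcts P) (h : s ⊆ F) : BFace P s := by
  obtain ⟨-, l, hl, rfl⟩ := mem_Fcts.1 hF
  exact hl.bface h

/-- A reference basis. -/
def refB (d : ℕ) : Module.Basis (Fin (d + 1)) ℝ ((Fin d → ℝ) × ℝ) :=
  Module.finBasisOfFinrankEq ℝ _ finrankW

/-- An enumeration of the lifted vertices of a facet together with the origin vector. -/
def Enum (P : SPolytope d) (F : Finset (Fin d → ℝ)) (v : Fin (d + 1) → (Fin d → ℝ) × ℝ) : Prop :=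
  Function.Injective v ∧ Set.range v = insert (oo P) (lift '' (F : Set (Fin d → ℝ)))

/-- Volume of a facet cone. -/
def vol (P : SPolytope d) (F : Finset (Fin d → ℝ)) : ℝ :=
  if h : ∃ v, Enum P F v then |(refB d).det h.choose| else 1

lemma vol_eq {P : SPolytope d} {F} {v} (hv : Enum P F v) : vol P F = |(refB d).det v| := by
  have h : ∃ v, Enum P F v := ⟨v, hv⟩
  rw [vol, dif_pos h]
  have hw := h.choose_spec
  set w := h.choose
  let σ : Equiv.Perm (Fin (d + 1)) := (Equiv.ofInjective v hv.1).trans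
    ((Equiv.setCongr (hv.2.trans hw.2.symm)).trans (Equiv.ofInjective w hw.1).symm)
  have hσ : v = w ∘ σ := by
    funext i
    have : (Equiv.ofInjective w hw.1 (σ i)).1 = v i := by simp [σ]
    exact this.symm
  rw [hσ, AlternatingMap.map_perm]
  rcases Int.units_eq_one_or (Equiv.Perm.sign σ) with h | h <;> simp [h]

lemma facet_data {P : SPolytope d} {F} (hF : F ∈ Fcts P) :
    ∃ (l : ((Fin d → ℝ) × ℝ) →ₗ[ℝ] ℝ) (c : (Fin d → ℝ) → ((Fin d → ℝ) × ℝ) →ₗ[ℝ] ℝ),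
      Supp P l ∧ F = Z P l ∧ l (oo P) = 1 ∧
      (∀ a, a = ∑ x ∈ F, c x a • lift x + l a • oo P) ∧
      (∀ x ∈ F, c x (oo P) = 0) ∧ (∀ x ∈ F, c x (lift x) = 1) ∧
      (∀ x ∈ F, ∀ y ∈ F, x ≠ y → c x (lift y) = 0) ∧
      ∃ v, Enum P F v ∧ (refB d).det v ≠ 0 := by
  obtain ⟨hcard, l, hl, hFZ⟩ := mem_Fcts.1 hF
  subst hFZ
  have ho := hl.o_pos
  have hc : Fintype.card (Option (Z P l)) = Module.finrank ℝ ((Fin d → ℝ) × ℝ) := by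
    rw [finrankW]; simp [hcard]
  let b := basisOfLinearIndependentOfCardEqFinrank hl.li_opt hc
  have hb : ⇑b = (fun i : Option (Z P l) => i.elim (oo P) (fun x => lift (x : Fin d → ℝ))) :=
    coe_basisOfLinearIndependentOfCardEqFinrank _ _
  have hbn : b none = oo P := by rw [hb]; rfl
  have hbs : ∀ x, b (some x) = lift (x : Fin d → ℝ) := by intro x; rw [hb]; rfl
  have hln : b.coord none = (l (oo P))⁻¹ • l := by
    apply b.ext
    rintro (_ | x)
    · rw [Module.Basis.coord_apply, Module.Basis.repr_self, hbn]
      simp only [Finsupp.single_eq_same, LinearMap.smul_apply, smul_eq_mul]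
      rw [inv_mul_cancel₀ ho.ne']
    · rw [Module.Basis.coord_apply, Module.Basis.repr_self, hbs, LinearMap.smul_apply,
        (mem_Z.1 x.2).2]
      simp
  let c : (Fin d → ℝ) → ((Fin d → ℝ) × ℝ) →ₗ[ℝ] ℝ := fun x =>
    if hx : x ∈ Z P l then b.coord (some ⟨x, hx⟩) else 0
  have hcx : ∀ x (hx : x ∈ Z P l), c x = b.coord (some ⟨x, hx⟩) := fun x hx => dif_pos hx
  have hZ' : Z P (b.coord none) = Z P l := by
    ext x
    rw [mem_Z, mem_Z, hln]
    simp [ho.ne']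
  refine ⟨b.coord none, c, ⟨?_, ?_⟩, hZ'.symm, ?_, ?_, ?_, ?_, ?_, ?_⟩
  · rw [hln]
    exact smul_ne_zero (inv_ne_zero ho.ne') hl.1
  · intro v hv
    rw [hln]
    exact mul_nonneg (inv_nonneg.2 ho.le) (hl.2 v hv)
  · rw [← hbn]; simp
  · intro a
    conv_lhs => rw [← b.sum_repr a, Fintype.sum_option]
    rw [add_comm, hbn]
    congr 1
    rw [← sum_coe_sort (Z P l)]
    refine sum_congr rfl fun x _ => ?_
    rw [hbs, hcx _ x.2]
    rfl
  · intro x hx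
    rw [hcx x hx, ← hbn]; simp
  · intro x hx
    rw [hcx x hx]
    have := hbs ⟨x, hx⟩
    simp only at this
    rw [← this]; simp
  · intro x hx y hy hxy
    rw [hcx x hx]
    have := hbs ⟨y, hy⟩
    simp only at this
    rw [← this]
    simp only [Module.Basis.coord_apply, Module.Basis.repr_self]
    rw [Finsupp.single_apply, if_neg]
    simpa using fun h : y = x => hxy h.symm
  · rw [finrankW] at hc
    let e : Option (Z P l) ≃ Fin (d + 1) := Fintype.equivFinOfCardEq hc
    refine ⟨b.reindex e, ⟨(b.reindex e).injective, ?_⟩, ((refB d).isUnit_det _).ne_zero⟩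
    rw [Module.Basis.range_reindex, hb]
    ext a
    simp only [Set.mem_range, Option.exists, Option.elim, Set.mem_insert_iff, Set.mem_image]
    constructor
    · rintro (h | ⟨x, h⟩)
      · exact Or.inl h.symm
      · exact Or.inr ⟨x, x.2, h⟩
    · rintro (h | ⟨x, hx, h⟩)
      · exact Or.inl h.symm
      · exact Or.inr ⟨⟨x, hx⟩, h⟩

/-- Chosen facet functional. -/
def fl (P : SPolytope d) (F : Finset (Fin d → ℝ)) : ((Fin d → ℝ) × ℝ) →ₗ[ℝ] ℝ :=
  if hF : F ∈ Fcts P then (facet_data hF).choose else 0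

/-- Chosen facet coordinates. -/
def fc (P : SPolytope d) (F : Finset (Fin d → ℝ)) :
    (Fin d → ℝ) → ((Fin d → ℝ) × ℝ) →ₗ[ℝ] ℝ :=
  if hF : F ∈ Fcts P then (facet_data hF).choose_spec.choose else 0

lemma facet_spec {P : SPolytope d} {F} (hF : F ∈ Fcts P) :
    Supp P (fl P F) ∧ F = Z P (fl P F) ∧ fl P F (oo P) = 1 ∧
      (∀ a, a = ∑ x ∈ F, fc P F x a • lift x + fl P F a • oo P) ∧
      (∀ x ∈ F, fc P F x (oo P) = 0) ∧ (∀ x ∈ F, fc P F x (lift x) = 1) ∧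
      (∀ x ∈ F, ∀ y ∈ F, x ≠ y → fc P F x (lift y) = 0) ∧
      ∃ v, Enum P F v ∧ (refB d).det v ≠ 0 := by
  have := (facet_data hF).choose_spec.choose_spec
  rw [fl, fc, dif_pos hF, dif_pos hF]
  exact this

lemma vol_adj {P : SPolytope d} {F} (hF : F ∈ Fcts P) {x y} (hx : x ∈ F) (hy : y ∉ F)
    (hG : insert y (F.erase x) ∈ Fcts P) :
    vol P (insert y (F.erase x)) = |fc P F x (lift y)| * vol P F := by
  obtain ⟨hl, hZ, hlo, hdec, hco, hcs, hcn, v, hv, hdet⟩ := facet_spec hF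
  have hxr : lift x ∈ Set.range v := by
    rw [hv.2]; exact Or.inr ⟨x, hx, rfl⟩
  obtain ⟨i, hi⟩ := hxr
  have hlz : ∀ q ∈ F, fl P F (lift q) = 0 := by
    intro q hq; rw [hZ] at hq; exact (mem_Z.1 hq).2
  have hox : ∀ q ∈ F, lift q ≠ oo P := by
    intro q hq h
    have := hlz q hq
    rw [h, hlo] at this
    norm_num at this
  have hyo : lift y ≠ oo P := by
    intro h
    obtain ⟨_, hZ2, hlo2, _⟩ := facet_spec hG
    have h1 : y ∈ Z P (fl P (insert y (F.erase x))) := hZ2 ▸ mem_insert_self _ _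
    have h2 := (mem_Z.1 h1).2
    rw [h, hlo2] at h2
    norm_num at h2
  have hupd : ∀ j, j ≠ i → ((refB d).det (Function.update v i (v j)) = 0) := by
    intro j hj
    apply AlternatingMap.map_eq_zero_of_eq (i := i) (j := j) _ _ _ hj.symm
    rw [Function.update_self, Function.update_of_ne hj]
  have hupd2 : ∀ a ∈ Set.range v, a ≠ lift x → ((refB d).det (Function.update v i a) = 0) := by
    rintro _ ⟨j, rfl⟩ hne
    exact hupd j fun h => hne (by rw [h, hi])
  have hen : Enum P (insert y (F.erase x)) (Function.update v i (lift y)) := by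
    have hyr : lift y ∉ Set.range v := by
      rw [hv.2]
      rintro (h | ⟨q, hq, h⟩)
      · exact hyo h
      · exact hy (lift_inj h ▸ hq)
    constructor
    · intro a b hab
      by_cases ha : a = i <;> by_cases hb : b = i
      · rw [ha, hb]
      · rw [ha, Function.update_self, Function.update_of_ne hb] at hab
        exact absurd ⟨b, hab.symm⟩ hyr
      · rw [hb, Function.update_self, Function.update_of_ne ha] at hab
        exact absurd ⟨a, hab⟩ hyr
      · rw [Function.update_of_ne ha, Function.update_of_ne hb] at hab
        exact hv.1 hab
    · ext a
      constructor
      · rintro ⟨j, rfl⟩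
        by_cases hj : j = i
        · rw [hj, Function.update_self]
          exact Or.inr ⟨y, by simp, rfl⟩
        · rw [Function.update_of_ne hj]
          have : v j ∈ Set.range v := ⟨j, rfl⟩
          rw [hv.2] at this
          rcases this with h | ⟨q, hq, h⟩
          · exact Or.inl h
          · refine Or.inr ⟨q, ?_, h⟩
            have hqx : q ≠ x := by
              rintro rfl
              exact hj (hv.1 (h.symm.trans hi.symm))
            rw [mem_coe, mem_insert, mem_erase]
            exact Or.inr ⟨hqx, hq⟩
      · have aux : ∀ a ∈ Set.range v, a ≠ lift x →
            a ∈ Set.range (Function.update v i (lift y)) := by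
          rintro _ ⟨j, rfl⟩ hne
          refine ⟨j, Function.update_of_ne ?_ _ _⟩
          rintro rfl
          exact hne hi
        rintro (h | ⟨q, hq, h⟩)
        · apply aux a
          · rw [hv.2]; exact Or.inl h
          · rw [h]; exact (hox x hx).symm
        · rw [mem_coe, mem_insert, mem_erase] at hq
          rcases hq with rfl | ⟨h1, h2⟩
          · exact ⟨i, by rw [Function.update_self]; exact h⟩
          · apply aux a
            · rw [hv.2]; exact Or.inr ⟨q, h2, h⟩
            · rw [← h]; exact fun h => h1 (lift_inj h)
  rw [vol_eq hen, vol_eq hv, ← abs_mul]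
  congr 1
  let D : ((Fin d → ℝ) × ℝ) →ₗ[ℝ] ℝ := (refB d).det.toMultilinearMap.toLinearMap v i
  have hD : ∀ a, D a = (refB d).det (Function.update v i a) := fun a => rfl
  rw [← hD]
  conv_lhs => rw [hdec (lift y)]
  rw [map_add, map_sum, map_smul, sum_eq_single_of_mem x hx]
  · rw [map_smul, hD, hD, hupd2 (oo P) (by rw [hv.2]; exact Or.inl rfl) (hox x hx).symm, ← hi,
      Function.update_eq_self]
    simp
  · intro q hq hqx
    rw [map_smul, hD, hupd2 (lift q) (by rw [hv.2]; exact Or.inr ⟨q, hq, rfl⟩)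
      (fun h => hqx (lift_inj h))]
    simp

lemma adj_facet {P : SPolytope d} {F} (hF : F ∈ Fcts P) {x} (hx : x ∈ F) :
    ∃ y, y ∉ F ∧ insert y (F.erase x) ∈ Fcts P := by
  obtain ⟨hl, hZ, hlo, hdec, hco, hcs, hcn, -⟩ := facet_spec hF
  have hlz : ∀ q ∈ F, fl P F (lift q) = 0 := by
    intro q hq; rw [hZ] at hq; exact (mem_Z.1 hq).2
  obtain ⟨t, ht, y, hyV, hyZ, hy0⟩ := hl.rotate (fc P F x) (by
    intro q hq
    rw [← hZ] at hq
    by_cases h : x = q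
    · subst h; rw [hcs x hx]; norm_num
    · rw [hcn x hx q hq h])
  rw [← hZ] at hyZ
  have hs : Supp P (fc P F x + t • fl P F) := by
    refine ⟨fun h => ?_, ht⟩
    have := LinearMap.congr_fun h (lift x)
    simp [hcs x hx, hlz x hx] at this
  have hcard := (mem_Fcts.1 hF).1
  have hpos := card_pos.2 ⟨x, hx⟩
  have hc2 : (insert y (F.erase x)).card = d := by
    rw [card_insert_of_notMem (fun h => hyZ (mem_of_mem_erase h)), card_erase_of_mem hx]
    omega
  refine ⟨y, hyZ, mem_Fcts.2 ⟨hc2, _, hs, ?_⟩⟩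
  apply eq_of_subset_of_card_le
  · intro q hq
    rcases mem_insert.1 hq with rfl | hq
    · exact mem_Z.2 ⟨hyV, hy0⟩
    · obtain ⟨h1, h2⟩ := mem_erase.1 hq
      refine mem_Z.2 ⟨?_, ?_⟩
      · rw [hZ] at h2; exact (mem_Z.1 h2).1
      · simp [hcn x hx q h2 h1.symm, hlz q h2]
  · rw [hc2]; exact hs.card_le

/-- The combinatorial-geometric data attached to a simplicial polytope. -/
def sph (P : SPolytope d) : SphData (Fin d → ℝ) ((Fin d → ℝ) × ℝ) d where
  p := lift
  o := oo P
  Fs := Fcts P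
  l := fl P
  c := fc P
  vol := vol P
  card_eq F hF := (mem_Fcts.1 hF).1
  l_o F hF := (facet_spec hF).2.2.1
  l_zero F hF x hx := by
    rw [(facet_spec hF).2.1] at hx; exact (mem_Z.1 hx).2
  l_pos F hF G hG x hx hxF := by
    have hxV : x ∈ P.V := by
      rw [(facet_spec hG).2.1] at hx; exact (mem_Z.1 hx).1
    refine lt_of_le_of_ne ((facet_spec hF).1.2 x hxV) fun h => hxF ?_
    rw [(facet_spec hF).2.1]
    exact mem_Z.2 ⟨hxV, h.symm⟩
  decomp F hF := (facet_spec hF).2.2.2.1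
  c_o F hF := (facet_spec hF).2.2.2.2.1
  c_self F hF := (facet_spec hF).2.2.2.2.2.1
  c_ne F hF := (facet_spec hF).2.2.2.2.2.2.1
  vol_pos F hF := by
    obtain ⟨v, hv, h⟩ := (facet_spec hF).2.2.2.2.2.2.2
    rw [vol_eq hv]
    exact abs_pos.2 h
  adj F hF x hx := by
    obtain ⟨y, hy, hG⟩ := adj_facet hF hx
    have hV := vol_adj hF hx hy hG
    refine ⟨y, hy, ?_, ?_⟩
    · convert hG
    · convert hV

lemma exists_gen (P : SPolytope d) : ∃ r, (sph P).Gen r := by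
  obtain ⟨r, hr⟩ := Module.Dual.exists_forall_ne_zero_of_forall_exists
    (ι := {q : Fcts P × P.V // q.2.1 ∈ q.1.1})
    (K := ℝ) (M := (Fin d → ℝ) × ℝ) (fun q => fc P q.1.1.1 q.1.2.1) (by
      rintro ⟨⟨⟨F, hF⟩, ⟨x, hxV⟩⟩, hx⟩
      refine ⟨lift x, ?_⟩
      rw [(facet_spec hF).2.2.2.2.2.1 x hx]
      norm_num)
  refine ⟨r, fun F hF x hx => ?_⟩
  have hxV : x ∈ P.V := by
    have hx' := hx
    have hF' : F ∈ Fcts P := hF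
    rw [(facet_spec hF').2.1] at hx'; exact (mem_Z.1 hx').1
  exact hr ⟨(⟨F, hF⟩, ⟨x, hxV⟩), hx⟩

/-- Rows of the rigidity matrix. -/
def row (P : SPolytope d) (f : Finset (Fin d → ℝ)) : P.V → Fin d → ℝ :=
  fun x => if (x : Fin d → ℝ) ∈ f then ∑ y ∈ f.erase (x : Fin d → ℝ), ((x : Fin d → ℝ) - y) else 0

lemma row_pair (P : SPolytope d) {a b : Fin d → ℝ} (ha : a ∈ P.V) (hb : b ∈ P.V) (hab : a ≠ b) :
    row P {a, b} = Pi.single (⟨a, ha⟩ : P.V) (a - b) + Pi.single (⟨b, hb⟩ : P.V) (b - a) := by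
  funext x
  obtain ⟨x, hx⟩ := x
  by_cases h1 : x = a
  · subst h1
    have h2 : ({x, b} : Finset (Fin d → ℝ)).erase x = {b} := by
      rw [erase_insert]; simpa using hab
    simp [row, h2, hab]
  · by_cases h2 : x = b
    · subst h2
      have h3 : ({a, x} : Finset (Fin d → ℝ)).erase x = {a} := by
        rw [pair_comm, erase_insert]; simpa using h1
      simp [row, h3, h1]
    · simp [row, h1, h2]

lemma stress_of_span (P : SPolytope d) (e : Finset (Fin d → ℝ)) (he : e ∈ edgeFinset P)
    (h : row P e ∈ Submodule.span ℝ (row P '' ((edgeFinset P).erase e : Set (Finset (Fin d → ℝ))))) :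
    ∃ ω : Finset (Fin d → ℝ) → ℝ, IsStress (fullGraph P) (fun x => x) ω ∧ ω e ≠ 0 := by
  rw [Submodule.mem_span_image_finset_iff_exists_fun] at h
  obtain ⟨c0, hc0⟩ := h
  obtain ⟨c, hc⟩ : ∃ c : Finset (Fin d → ℝ) → ℝ,
      ∑ f ∈ (edgeFinset P).erase e, c f • row P f = row P e := by
    refine ⟨fun f => if hf : f ∈ (edgeFinset P).erase e then c0 ⟨f, hf⟩ else 0, ?_⟩
    rw [← hc0, ← sum_coe_sort]
    refine sum_congr rfl fun f _ => ?_
    simp only [dif_pos f.2]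
  refine ⟨fun f => if f = e then -1 else c f, ?_, by simp⟩
  intro x hx
  change x ∈ P.V at hx
  have h1 : ∑ f ∈ edgeFinset P, (if f = e then -1 else c f) • row P f ⟨x, hx⟩ = 0 := by
    rw [← add_sum_erase _ _ he, if_pos rfl]
    have h2 := congrFun hc ⟨x, hx⟩
    rw [Finset.sum_apply] at h2
    have h3 : ∑ f ∈ (edgeFinset P).erase e, (if f = e then -1 else c f) • row P f ⟨x, hx⟩
        = ∑ f ∈ (edgeFinset P).erase e, (c f • row P f) ⟨x, hx⟩ := by
      refine sum_congr rfl fun f hf => ?_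
      rw [if_neg (mem_erase.1 hf).1]; rfl
    rw [h3, h2]
    simp
  rw [← h1, fullGraph, sum_filter]
  refine sum_congr rfl fun f _ => ?_
  by_cases hf : x ∈ f
  · simp only [row, if_pos hf]
    rw [smul_sum]
    congr!
  · simp only [row, if_neg hf]
    rw [smul_zero]

lemma key {d : ℕ} (hd : 4 ≤ d) (P : SPolytope d) (u v w z : Fin d → ℝ)
    (huv : u ≠ v)
    (h1 : BFace P {u, v}) (h2 : BFace P {v, w}) (h3 : BFace P {w, z}) (h4 : BFace P {z, u})
    (h5 : ¬ BFace P {u, w}) (h6 : ¬ BFace P {v, z}) :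
    ∃ ω : Finset (Fin d → ℝ) → ℝ, IsStress (fullGraph P) (fun x => x) ω ∧ ω {u, v} ≠ 0 := by
  have he : ({u, v} : Finset (Fin d → ℝ)) ∈ edgeFinset P := by
    rw [edgeFinset, mem_filter, mem_powerset]
    exact ⟨h1.1, card_pair huv, h1⟩
  have hu : u ∈ P.V := h1.1 (by simp)
  have hv : v ∈ P.V := h1.1 (by simp)
  by_contra hcon
  have hns := fun h => hcon (stress_of_span P _ he h)
  obtain ⟨φ, hφ, hk⟩ := Submodule.exists_le_ker_of_notMem hns
  let mm : (Fin d → ℝ) → (Fin d → ℝ) →ₗ[ℝ] ℝ := fun x =>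
    if hx : x ∈ P.V then φ ∘ₗ LinearMap.single ℝ (fun _ : P.V => Fin d → ℝ) ⟨x, hx⟩ else 0
  have hmm : ∀ x (hx : x ∈ P.V) a, mm x a = φ (Pi.single (⟨x, hx⟩ : P.V) a) := by
    intro x hx a
    simp only [mm, dif_pos hx]
    rfl
  let M : (Fin d → ℝ) → ((Fin d → ℝ) × ℝ) →ₗ[ℝ] ℝ := fun x =>
    mm x ∘ₗ LinearMap.fst ℝ _ _ - (mm x x) • LinearMap.snd ℝ _ _
  have hM : ∀ x y, M x (lift y) = mm x y - mm x x := by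
    intro x y; simp [M, lift]
  have hrow : ∀ x ∈ P.V, ∀ y ∈ P.V, x ≠ y →
      M x (lift y) + M y (lift x) = - φ (row P {x, y}) := by
    intro x hx y hy hxy
    rw [row_pair P hx hy hxy, map_add, ← hmm, ← hmm, hM, hM, map_sub, map_sub]
    ring
  have hmot : ∀ q, (∀ F ∈ Fcts P, q ∈ F → ¬ ({u, v} : Finset (Fin d → ℝ)) ⊆ F) →
      (sph P).Mot q M := by
    intro q hq F hF hqF x hx y hy
    show M x (lift y) + M y (lift x) = 0
    by_cases hxy : x = y
    · subst hxy; rw [hM]; ring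
    have hsub : ({x, y} : Finset (Fin d → ℝ)) ⊆ F := by
      intro a ha
      rcases mem_insert.1 ha with rfl | ha
      · exact hx
      · rw [mem_singleton.1 ha]; exact hy
    have hb : BFace P {x, y} := facet_bface hF hsub
    rw [hrow x (hb.1 (by simp)) y (hb.1 (by simp)) hxy, neg_eq_zero]
    apply hk
    apply Submodule.subset_span
    refine ⟨{x, y}, ?_, rfl⟩
    rw [mem_coe, mem_erase, edgeFinset, mem_filter, mem_powerset]
    exact ⟨fun h => hq F hF hqF (h ▸ hsub), hb.1, card_pair hxy, hb⟩
  obtain ⟨r, hr⟩ := exists_gen P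
  have hex : ∀ a b, BFace P {a, b} → ∃ F ∈ (sph P).Fs, a ∈ F ∧ b ∈ F := by
    intro a b h
    obtain ⟨F, hF, hs⟩ := bface_facet h
    exact ⟨F, hF, hs (by simp), hs (by simp)⟩
  have hfin := SphData.main (S := sph P) (r := r) (M := M) (u := u) (v := v) (w := w) (z := z)
    hr hd
    (hmot w fun F hF hq hs => h5 (facet_bface hF (by
      intro a ha
      rcases mem_insert.1 ha with rfl | ha
      · exact hs (by simp)
      · rw [mem_singleton.1 ha]; exact hq)))
    (hmot z fun F hF hq hs => h6 (facet_bface hF (by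
      intro a ha
      rcases mem_insert.1 ha with rfl | ha
      · exact hs (by simp)
      · rw [mem_singleton.1 ha]; exact hq)))
    (hex w z h3) (hex v w h2) (hex z u h4)
  have h7 := hrow u hu v hv huv
  change M u (lift v) + M v (lift u) = 0 at hfin
  rw [hfin] at h7
  exact hφ (by linarith)

end SPC

/-- Let `d ≥ 4` and let `P` be a simplicial `d`-polytope whose graph contains
a chordless 4-cycle `(u, v, w, z)`. Then for each edge `e` of the cycle there is a stress
on the full graph of `∂P` (with the natural embedding) that is nonzero on `e`. -/
theorem stmt6 {d : ℕ} (hd : 4 ≤ d) (P : SPolytope d) (u v w z : Fin d → ℝ)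
    (hu : u ∈ P.V) (hv : v ∈ P.V) (hw : w ∈ P.V) (hz : z ∈ P.V)
    (huv : u ≠ v) (huw : u ≠ w) (huz : u ≠ z) (hvw : v ≠ w) (hvz : v ≠ z) (hwz : w ≠ z)
    (h1 : BFace P {u, v}) (h2 : BFace P {v, w}) (h3 : BFace P {w, z}) (h4 : BFace P {z, u})
    (h5 : ¬ BFace P {u, w}) (h6 : ¬ BFace P {v, z}) :
    ∀ e : Finset (Fin d → ℝ),
      (e = {u, v} ∨ e = {v, w} ∨ e = {w, z} ∨ e = {z, u}) →
      ∃ ω : Finset (Fin d → ℝ) → ℝ, IsStress (fullGraph P) (fun x => x) ω ∧ ω e ≠ 0 := by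
  have c1 : ({w, u} : Finset (Fin d → ℝ)) = {u, w} := pair_comm _ _
  have c2 : ({z, v} : Finset (Fin d → ℝ)) = {v, z} := pair_comm _ _
  have h5' : ¬ BFace P {w, u} := by rw [c1]; exact h5
  have h6' : ¬ BFace P {z, v} := by rw [c2]; exact h6
  rintro e (rfl | rfl | rfl | rfl)
  · exact SPC.key hd P u v w z huv h1 h2 h3 h4 h5 h6
  · exact SPC.key hd P v w z u hvw h2 h3 h4 h1 h6 h5'
  · exact SPC.key hd P w z u v hwz h3 h4 h1 h2 h5' h6'
  · exact SPC.key hd P z u v w huz.symm h4 h1 h2 h3 h6' h5
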